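/- Let γ > 7/2 and let δ satisfy 5/2 < δ < γ − 1, and set β_i = i^δ for i ≥ 1. Let μ^{(n)} be the Feynman–Thomas measure on ℝⁿ, the complex measure with density ρ_n(x) = ∫_{(0,∞)ⁿ} [ Π_{i=1}^{n} (1/β_i) e^{−s_i/β_i} ] g_{s,n}(x) ds₁…dsₙ, where g_{s,n}(x) = (2π)^{−n} ∫_{ℝⁿ} exp( −⟨(diag(s) + i K^{(n)})ξ, ξ⟩/2 − i⟨ξ, x⟩ ) dξ and K^{(n)}_{jk} = min(j,k). Then there exists a complex measure μ of finite total variation on the product measurable space ℝ^{ℕ≥1} (with the product σ-algebra) such that for every n ≥ 1 the pushforward of μ under the coordinate projection (x_i)_{i≥1} ↦ (x₁,…,xₙ) equals μ^{(n)}, and the total variation measure |μ| gives full mass to the set { x ∈ ℝ^{ℕ≥1} : Σ_{i=1}^{∞} i^{−γ} x_i² < ∞ }, i.e. μ is concentrated on the Hilbert space l²_{−γ}. -/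

import Mathlib

open MeasureTheory Matrix Set

/-- The discrete-time Brownian covariance matrix `K^{(n)}_{jk} = min(j,k)` (indices
`j,k : Fin n` standing for the indices `j+1, k+1 ∈ {1,…,n}` of the paper). -/
def Kmin (n : ℕ) : Matrix (Fin n) (Fin n) ℝ :=
  Matrix.of fun j k => ((min ((j : ℕ) + 1) ((k : ℕ) + 1) : ℕ) : ℝ)

/-- `A^{(n)}(s) = diag(s₁,…,sₙ) + i·K^{(n)}`. -/
noncomputable def Amat (n : ℕ) (s : Fin n → ℝ) : Matrix (Fin n) (Fin n) ℂ :=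
  (Matrix.diagonal s).map Complex.ofReal + Complex.I • (Kmin n).map Complex.ofReal

/-- `g_{s,n}(x) = (2π)^{−n} ∫_{ℝⁿ} exp(−⟨A^{(n)}(s)ξ,ξ⟩/2 − i⟨ξ,x⟩) dξ`. -/
noncomputable def gsn (n : ℕ) (s : Fin n → ℝ) (x : Fin n → ℝ) : ℂ :=
  (((2 * Real.pi) ^ n : ℝ)⁻¹ : ℝ) •
    ∫ ξ : Fin n → ℝ,
      Complex.exp (-(∑ j : Fin n, ∑ k : Fin n, Amat n s j k * (ξ j : ℂ) * (ξ k : ℂ)) / 2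
        - Complex.I * (∑ j : Fin n, (ξ j : ℂ) * (x j : ℂ)))

/-- The density `ρ_n(x) = ∫_{(0,∞)ⁿ} Π_i (1/β_i)e^{−s_i/β_i} · g_{s,n}(x) ds` of the
Feynman–Thomas measure `μ^{(n)}` on `ℝⁿ`. -/
noncomputable def rhoFT (β : ℕ → ℝ) (n : ℕ) (x : Fin n → ℝ) : ℂ :=
  ∫ s in Set.univ.pi (fun _ : Fin n => Ioi (0 : ℝ)),
    ((∏ i : Fin n, (β (i : ℕ))⁻¹ * Real.exp (-(s i) / β (i : ℕ)) : ℝ) : ℂ) * gsn n s x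

lemma Matrix.PosSemidef.det_le_prod_diag {ι : Type*} [Fintype ι] [DecidableEq ι]
    {M : Matrix ι ι ℝ} (hM : M.PosSemidef) (hd : ∀ i, 0 < M i i) :
    M.det ≤ ∏ i, M i i := by
  set E : Matrix ι ι ℝ := diagonal fun i => (√(M i i))⁻¹ with hE
  have hN : (E * M * E).PosSemidef := by
    have := hM.mul_mul_conjTranspose_same E
    simpa [hE, diagonal_conjTranspose] using this
  have hdet : (E * M * E).det = M.det / ∏ i, M i i := by
    have hp : ∀ i, √(M i i) * √(M i i) = M i i := fun i => Real.mul_self_sqrt (hd i).le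
    rw [det_mul, det_mul, hE, det_diagonal, Finset.prod_inv_distrib]
    have : (∏ i, √(M i i)) * (∏ i, √(M i i)) = ∏ i, M i i := by
      rw [← Finset.prod_mul_distrib]; exact Finset.prod_congr rfl fun i _ => hp i
    rw [← this]
    have h0 : (∏ i, √(M i i)) ≠ 0 := by
      refine Finset.prod_ne_zero_iff.2 fun i _ => (Real.sqrt_pos.2 (hd i)).ne'
    field_simp
  have htr : (E * M * E).trace = Fintype.card ι := by
    have h1 : ∀ i, (E * M * E) i i = 1 := fun i => by
      have h0 : √(M i i) ≠ 0 := (Real.sqrt_pos.2 (hd i)).ne'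
      have h2 := Real.mul_self_sqrt (hd i).le
      rw [hE, mul_diagonal, diagonal_mul]
      field_simp
      nlinarith
    simp [Matrix.trace, h1]
  have hle : (E * M * E).det ≤ 1 := by
    rw [hN.isHermitian.det_eq_prod_eigenvalues]
    calc (∏ i, (hN.isHermitian.eigenvalues i : ℝ))
        ≤ ∏ i, Real.exp (hN.isHermitian.eigenvalues i - 1) := by
          refine Finset.prod_le_prod (fun i _ => hN.eigenvalues_nonneg i) fun i _ => ?_
          linarith [Real.add_one_le_exp (hN.isHermitian.eigenvalues i - 1)]
      _ = 1 := by
          rw [← Real.exp_sum, Finset.sum_sub_distrib]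
          have := hN.isHermitian.trace_eq_sum_eigenvalues
          simp only [RCLike.ofReal_real_eq_id, id] at this
          rw [← this, htr]; simp
  rw [hdet, div_le_one (Finset.prod_pos fun i _ => hd i)] at hle
  exact hle

/-- Simultaneous diagonalization of a positive diagonal form and a positive semidefinite form. -/
lemma exists_simultaneous_diagonalization {ι : Type*} [Fintype ι] [DecidableEq ι]
    {K : Matrix ι ι ℝ} (hK : K.PosSemidef) {s : ι → ℝ} (hs : ∀ i, 0 < s i) :
    ∃ (M : Matrix ι ι ℝ) (l : ι → ℝ), (∀ i, 0 ≤ l i) ∧ Mᵀ * diagonal s * M = 1 ∧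
      Mᵀ * K * M = diagonal l := by
  set E : Matrix ι ι ℝ := diagonal fun i => (√(s i))⁻¹ with hE
  have hN : (E * K * E).PosSemidef := by
    have := hK.mul_mul_conjTranspose_same E
    simpa [hE, diagonal_conjTranspose] using this
  have hET : Eᵀ = E := by simp [hE]
  set U : Matrix ι ι ℝ := (hN.isHermitian.eigenvectorUnitary : Matrix ι ι ℝ) with hU
  have hUU : Uᵀ * U = 1 := by
    have := Unitary.coe_star_mul_self hN.isHermitian.eigenvectorUnitary
    simpa [star_eq_conjTranspose, conjTranspose_eq_transpose_of_trivial] using this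
  refine ⟨E * U, hN.isHermitian.eigenvalues, hN.eigenvalues_nonneg, ?_, ?_⟩
  · have : E * diagonal s * E = 1 := by
      rw [hE, diagonal_mul_diagonal, diagonal_mul_diagonal, ← diagonal_one]
      congr 1; ext i
      have h0 : √(s i) ≠ 0 := (Real.sqrt_pos.2 (hs i)).ne'
      have h2 := Real.mul_self_sqrt (hs i).le
      field_simp
      nlinarith
    calc (E * U)ᵀ * diagonal s * (E * U) = Uᵀ * (E * diagonal s * E) * U := by
          rw [transpose_mul, hET]; simp only [Matrix.mul_assoc]
      _ = 1 := by rw [this, Matrix.mul_one, hUU]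
  · have h1 := hN.isHermitian.spectral_theorem
    rw [Unitary.conjStarAlgAut_apply] at h1
    have h3 : star (hN.isHermitian.eigenvectorUnitary : Matrix ι ι ℝ) = Uᵀ := by
      simp [hU, star_eq_conjTranspose, conjTranspose_eq_transpose_of_trivial]
    rw [h3, ← hU] at h1
    have h2 : (RCLike.ofReal ∘ hN.isHermitian.eigenvalues : ι → ℝ)
      = hN.isHermitian.eigenvalues := by ext; simp
    rw [h2] at h1
    calc (E * U)ᵀ * K * (E * U) = Uᵀ * (E * K * E) * U := by
          rw [transpose_mul, hET]; simp only [Matrix.mul_assoc]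
      _ = Uᵀ * (U * diagonal hN.isHermitian.eigenvalues * Uᵀ) * U := by
          conv_lhs => rw [h1]
      _ = (Uᵀ * U) * diagonal hN.isHermitian.eigenvalues * (Uᵀ * U) := by
          simp only [Matrix.mul_assoc]
      _ = _ := by rw [hUU]; simp

lemma Kmin_posSemidef (n : ℕ) : (Kmin n).PosSemidef := by
  have : Kmin n = (Matrix.of fun (l j : Fin n) => if l ≤ j then (1 : ℝ) else 0)ᴴ *
      (Matrix.of fun (l j : Fin n) => if l ≤ j then (1 : ℝ) else 0) := by
    ext j k
    simp only [Kmin, mul_apply, conjTranspose_apply, of_apply, star_trivial, mul_ite, mul_one,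
      mul_zero, ← ite_and]
    rw [Finset.sum_boole]
    congr 1
    have : (Finset.univ.filter fun x : Fin n => x ≤ k ∧ x ≤ j) = Finset.Iic (min j k) := by
      ext x; simp [and_comm]
    rw [this, Fin.card_Iic]
    simp
  rw [this]
  exact posSemidef_conjTranspose_mul_self _

lemma sum_Amat_eq (n : ℕ) (s ξ : Fin n → ℝ) :
    ∑ j : Fin n, ∑ k : Fin n, Amat n s j k * (ξ j : ℂ) * (ξ k : ℂ) =
      ((ξ ⬝ᵥ diagonal s *ᵥ ξ : ℝ) : ℂ) + Complex.I * ((ξ ⬝ᵥ Kmin n *ᵥ ξ : ℝ) : ℂ) := by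
  simp only [dotProduct, mulVec, Complex.ofReal_sum, Complex.ofReal_mul, Finset.mul_sum,
    ← Finset.sum_add_distrib, Amat, Matrix.add_apply, map_apply, Matrix.smul_apply, smul_eq_mul]
  refine Finset.sum_congr rfl fun j _ => Finset.sum_congr rfl fun k _ => ?_
  ring

lemma dotProduct_mulVec_comp {n : ℕ} (M S : Matrix (Fin n) (Fin n) ℝ) (η : Fin n → ℝ) :
    (M *ᵥ η) ⬝ᵥ S *ᵥ (M *ᵥ η) = η ⬝ᵥ (Mᵀ * S * M) *ᵥ η := by
  rw [← mulVec_mulVec, ← mulVec_mulVec, dotProduct_mulVec η, vecMul_transpose]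

lemma integral_comp_mulVec {n : ℕ} {F : Type*} [NormedAddCommGroup F] [NormedSpace ℝ F]
    {M : Matrix (Fin n) (Fin n) ℝ} (hM : M.det ≠ 0) {f : (Fin n → ℝ) → F}
    (hf : StronglyMeasurable f) :
    ∫ x, f x = |M.det| • ∫ y, f (M *ᵥ y) := by
  have h1 := Real.map_matrix_volume_pi_eq_smul_volume_pi hM
  have h2 : ∫ y, f (M *ᵥ y) = ∫ x, f x ∂(Measure.map (toLin' M) volume) := by
    rw [integral_map (LinearMap.continuous_of_finiteDimensional _).measurable.aemeasurable
      hf.aestronglyMeasurable]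
    simp
  rw [h2, h1, integral_smul_measure, ENNReal.toReal_ofReal (abs_nonneg _), smul_smul, abs_inv,
    mul_inv_cancel₀ (abs_ne_zero.2 hM), one_smul]

lemma lintegral_comp_mulVec {n : ℕ} {M : Matrix (Fin n) (Fin n) ℝ} (hM : M.det ≠ 0)
    {f : (Fin n → ℝ) → ENNReal} (hf : Measurable f) :
    ∫⁻ y, f (M *ᵥ y) = ENNReal.ofReal |M.det|⁻¹ * ∫⁻ x, f x := by
  have h1 := Real.map_matrix_volume_pi_eq_smul_volume_pi hM
  have h2 : ∫⁻ y, f (M *ᵥ y) = ∫⁻ x, f x ∂(Measure.map (toLin' M) volume) := by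
    rw [lintegral_map hf (LinearMap.continuous_of_finiteDimensional _).measurable]
    simp
  rw [h2, h1, lintegral_smul_measure, smul_eq_mul, abs_inv]

/-- The modulus of the Fourier transform of a complex Gaussian on the line. -/
lemma norm_integral_cexp_gaussian (l y : ℝ) :
    ‖∫ t : ℝ, Complex.exp (-((1 + Complex.I * l) * (t : ℂ) ^ 2) / 2 - Complex.I * (t * y))‖ =
      √(2 * Real.pi) * (1 + l ^ 2) ^ (-(1 / 4) : ℝ) * Real.exp (-(y ^ 2 / (1 + l ^ 2)) / 2) := by
  have hl : 0 < 1 + l ^ 2 := by positivity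
  have hb : (-(1 + Complex.I * l) / 2 : ℂ).re < 0 := by simp; norm_num
  have hns : Complex.normSq (1 + Complex.I * l) = 1 + l ^ 2 := by
    simp [Complex.normSq_apply]; ring
  have hne : (1 + Complex.I * l : ℂ) ≠ 0 := by
    rw [← Complex.normSq_pos, hns]; exact hl
  have hnorm : ‖(1 + Complex.I * l : ℂ)‖ = (1 + l ^ 2) ^ (1 / 2 : ℝ) := by
    rw [Complex.norm_def, hns, Real.sqrt_eq_rpow]
  have h := integral_cexp_quadratic hb (-(Complex.I * y)) 0
  have h1 : ∀ t : ℝ, Complex.exp (-((1 + Complex.I * l) * (t : ℂ) ^ 2) / 2 - Complex.I * (t * y))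
      = Complex.exp (-(1 + Complex.I * l) / 2 * t ^ 2 + -(Complex.I * y) * t + 0) := fun t => by
    congr 1; ring
  simp_rw [h1]
  rw [h, norm_mul, Complex.norm_exp]
  congr 1
  · have : ((1 : ℂ) / 2) = ((1 / 2 : ℝ) : ℂ) := by push_cast; rfl
    have hne2 : (Real.pi : ℂ) / -(-(1 + Complex.I * l) / 2) ≠ 0 := by
      refine div_ne_zero (by exact_mod_cast Real.pi_ne_zero) ?_
      refine neg_ne_zero.2 (div_ne_zero (neg_ne_zero.2 hne) two_ne_zero)
    rw [this, Complex.norm_cpow_real, norm_div, norm_neg, norm_div, norm_neg, hnorm]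
    simp only [Complex.norm_real, Complex.norm_ofNat, Real.norm_eq_abs, abs_of_pos Real.pi_pos]
    rw [div_div_eq_mul_div, Real.div_rpow (by positivity) (by positivity), ← Real.rpow_mul hl.le,
      Real.sqrt_eq_rpow, Real.rpow_neg hl.le, div_eq_mul_inv, mul_comm Real.pi]
    norm_num
  · congr 1
    have : (0 - (-(Complex.I * y)) ^ 2 / (4 * (-(1 + Complex.I * l) / 2)) : ℂ)
        = ((-(y ^ 2) / 2 : ℝ) : ℂ) * (1 + Complex.I * l)⁻¹ := by
      field_simp
      rw [Complex.I_sq]; push_cast; ring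
    rw [this, Complex.re_ofReal_mul, Complex.inv_re, hns]
    simp
    field_simp

lemma continuous_gsn_integrand (n : ℕ) (s x : Fin n → ℝ) : Continuous fun ξ : Fin n → ℝ =>
    Complex.exp (-(∑ j : Fin n, ∑ k : Fin n, Amat n s j k * (ξ j : ℂ) * (ξ k : ℂ)) / 2
        - Complex.I * (∑ j : Fin n, (ξ j : ℂ) * (x j : ℂ))) := by
  fun_prop

lemma norm_gsn {n : ℕ} {s l : Fin n → ℝ} {M : Matrix (Fin n) (Fin n) ℝ} (hM : M.det ≠ 0)
    (h1 : Mᵀ * diagonal s * M = 1) (h2 : Mᵀ * Kmin n * M = diagonal l) (x : Fin n → ℝ) :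
    ‖gsn n s x‖ = ((2 * Real.pi) ^ n)⁻¹ * (|M.det| * ∏ k, (√(2 * Real.pi) *
      (1 + l k ^ 2) ^ (-(1 / 4) : ℝ) * Real.exp (-((Mᵀ *ᵥ x) k ^ 2 / (1 + l k ^ 2)) / 2))) := by
  rw [gsn, norm_smul, Real.norm_of_nonneg (by positivity),
    integral_comp_mulVec hM (continuous_gsn_integrand n s x).stronglyMeasurable, norm_smul,
    Real.norm_eq_abs, abs_abs]
  congr 2
  have h3 : ∀ η : Fin n → ℝ,
      Complex.exp (-(∑ j : Fin n, ∑ k : Fin n,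
          Amat n s j k * ((M *ᵥ η) j : ℂ) * ((M *ᵥ η) k : ℂ)) / 2
        - Complex.I * (∑ j : Fin n, ((M *ᵥ η) j : ℂ) * (x j : ℂ))) =
      ∏ k, Complex.exp (-((1 + Complex.I * l k) * (η k : ℂ) ^ 2) / 2
        - Complex.I * (η k * ((Mᵀ *ᵥ x) k : ℝ))) := fun η => by
    rw [← Complex.exp_sum, sum_Amat_eq, dotProduct_mulVec_comp, dotProduct_mulVec_comp, h1, h2]
    congr 1
    have h4 : ∑ j : Fin n, ((M *ᵥ η) j : ℂ) * (x j : ℂ) =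
        ∑ k, (η k : ℂ) * ((Mᵀ *ᵥ x) k : ℝ) := by
      have : (M *ᵥ η) ⬝ᵥ x = η ⬝ᵥ (Mᵀ *ᵥ x) := by
        rw [dotProduct_mulVec, vecMul_transpose]
      simp only [dotProduct] at this
      exact_mod_cast this
    rw [h4, Finset.sum_sub_distrib, ← Finset.mul_sum]
    congr 1
    simp only [dotProduct, one_mulVec, mulVec_diagonal, Complex.ofReal_sum, Complex.ofReal_mul,
      Finset.mul_sum, ← Finset.sum_add_distrib, neg_div, Finset.sum_div, ← Finset.sum_neg_distrib]
    refine Finset.sum_congr rfl fun k _ => ?_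
    ring
  simp_rw [h3]
  rw [integral_fintype_prod_volume_eq_prod (fun k (t : ℝ) =>
    Complex.exp (-((1 + Complex.I * l k) * (t : ℂ) ^ 2) / 2
        - Complex.I * (t * ((Mᵀ *ᵥ x) k : ℝ)))), norm_prod]
  exact Finset.prod_congr rfl fun k _ => norm_integral_cexp_gaussian _ _

lemma det_sq_mul_prod {n : ℕ} {s : Fin n → ℝ} {M : Matrix (Fin n) (Fin n) ℝ}
    (h1 : Mᵀ * diagonal s * M = 1) : M.det ^ 2 * ∏ j, s j = 1 := by
  have := congrArg Matrix.det h1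
  rw [det_mul, det_mul, det_transpose, det_diagonal, det_one] at this
  linarith

lemma abs_det_eq {n : ℕ} {s : Fin n → ℝ} (hs : ∀ i, 0 < s i) {M : Matrix (Fin n) (Fin n) ℝ}
    (h1 : Mᵀ * diagonal s * M = 1) : |M.det| = ∏ j, (√(s j))⁻¹ := by
  have h := det_sq_mul_prod h1
  have hp : 0 < ∏ j, (√(s j))⁻¹ := Finset.prod_pos fun i _ => inv_pos.2 (Real.sqrt_pos.2 (hs i))
  have h2 : (∏ j, (√(s j))⁻¹) ^ 2 * ∏ j, s j = 1 := by
    rw [← Finset.prod_pow, ← Finset.prod_mul_distrib]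
    refine Finset.prod_eq_one fun i _ => ?_
    rw [inv_pow, Real.sq_sqrt (hs i).le, inv_mul_cancel₀ (hs i).ne']
  have hps : ∏ j, s j ≠ 0 := (Finset.prod_pos fun i _ => hs i).ne'
  have : |M.det| ^ 2 = (∏ j, (√(s j))⁻¹) ^ 2 := by
    rw [sq_abs]; exact mul_right_cancel₀ hps (h.trans h2.symm)
  exact (sq_eq_sq₀ (abs_nonneg _) hp.le).1 this

lemma sum_div_le_sum_of_form_le {n : ℕ} {s l d : Fin n → ℝ} (hs : ∀ i, 0 < s i) (hd : ∀ i, 0 ≤ d i)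
    {M K : Matrix (Fin n) (Fin n) ℝ}
    (h1 : Mᵀ * diagonal s * M = 1) (h2 : Mᵀ * K * M = diagonal l)
    (hK : ∀ ζ : Fin n → ℝ, ∑ i, (K *ᵥ ζ) i ^ 2 / s i ≤ ∑ j, d j * ζ j ^ 2) (x : Fin n → ℝ) :
    ∑ j, x j ^ 2 / (s j + d j) ≤ ∑ k, (Mᵀ *ᵥ x) k ^ 2 / (1 + l k ^ 2) := by
  have hv : ∀ j, 0 < s j + d j := fun j => add_pos_of_pos_of_nonneg (hs j) (hd j)
  have hMS : M * (Mᵀ * diagonal s) = 1 := mul_eq_one_comm.1 h1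
  have hMM : M * Mᵀ = diagonal fun i => (s i)⁻¹ := by
    have hinv : diagonal s * (diagonal fun i => (s i)⁻¹) = 1 := by
      rw [diagonal_mul_diagonal, ← diagonal_one]
      congr 1; ext i; exact mul_inv_cancel₀ (hs i).ne'
    calc M * Mᵀ = M * (Mᵀ * diagonal s) * (diagonal fun i => (s i)⁻¹) := by
          rw [Matrix.mul_assoc, Matrix.mul_assoc, hinv, Matrix.mul_one]
      _ = _ := by rw [hMS, Matrix.one_mul]
  set ζ : Fin n → ℝ := fun j => x j / (s j + d j) with hζ
  set w : Fin n → ℝ := (Mᵀ * diagonal s) *ᵥ ζ with hw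
  have hMw : M *ᵥ w = ζ := by rw [hw, mulVec_mulVec, hMS, one_mulVec]
  have ha : (Mᵀ *ᵥ x) ⬝ᵥ w = x ⬝ᵥ ζ := by
    rw [mulVec_transpose, ← dotProduct_mulVec, hMw]
  have hb : w ⬝ᵥ w = (diagonal s *ᵥ ζ) ⬝ᵥ ζ := by
    nth_rw 1 [hw]
    rw [← mulVec_mulVec, mulVec_transpose, ← dotProduct_mulVec, hMw]
  have hc : (diagonal l *ᵥ w) ⬝ᵥ (diagonal l *ᵥ w) =
      (K *ᵥ ζ) ⬝ᵥ ((diagonal fun i => (s i)⁻¹) *ᵥ (K *ᵥ ζ)) := by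
    rw [← h2, ← mulVec_mulVec, hMw, ← mulVec_mulVec, ← hMM, ← mulVec_mulVec]
    nth_rw 1 [mulVec_transpose]
    rw [← dotProduct_mulVec]
  simp only [dotProduct, mulVec_diagonal] at ha hb hc
  have hK' := hK ζ
  have hterm : ∀ k, 2 * ((Mᵀ *ᵥ x) k * w k) - w k * w k - l k * w k * (l k * w k) ≤
      (Mᵀ *ᵥ x) k ^ 2 / (1 + l k ^ 2) := fun k => by
    have : 0 < 1 + l k ^ 2 := by positivity
    rw [le_div_iff₀ this]
    nlinarith [sq_nonneg ((Mᵀ *ᵥ x) k - (1 + l k ^ 2) * w k)]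
  calc ∑ j, x j ^ 2 / (s j + d j)
      = 2 * (∑ j, x j * ζ j) - ∑ j, s j * ζ j * ζ j - ∑ j, d j * ζ j ^ 2 := by
        rw [Finset.mul_sum, ← Finset.sum_sub_distrib, ← Finset.sum_sub_distrib]
        refine Finset.sum_congr rfl fun j _ => ?_
        have := (hv j).ne'
        simp only [hζ]
        field_simp
        ring
    _ ≤ 2 * (∑ j, x j * ζ j) - ∑ j, s j * ζ j * ζ j - ∑ i, (K *ᵥ ζ) i ^ 2 / s i := by linarith
    _ = ∑ k, (2 * ((Mᵀ *ᵥ x) k * w k) - w k * w k - l k * w k * (l k * w k)) := by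
        rw [Finset.sum_sub_distrib, Finset.sum_sub_distrib, ← Finset.mul_sum, ha, hb, hc]
        congr 1
        refine Finset.sum_congr rfl fun i _ => ?_
        rw [div_eq_mul_inv]; ring
    _ ≤ _ := Finset.sum_le_sum fun k _ => hterm k

/-- A complex Gaussian is dominated pointwise by a product of real Gaussians. -/
lemma norm_gsn_le {n : ℕ} {s d : Fin n → ℝ} (hs : ∀ i, 0 < s i) (hd : ∀ i, 0 ≤ d i)
    (hK : ∀ ζ : Fin n → ℝ, ∑ i, (Kmin n *ᵥ ζ) i ^ 2 / s i ≤ ∑ j, d j * ζ j ^ 2)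
    (x : Fin n → ℝ) :
    ‖gsn n s x‖ ≤ ∏ j, ((√(2 * Real.pi * s j))⁻¹ * Real.exp (-(x j ^ 2 / (s j + d j)) / 2)) := by
  obtain ⟨M, l, -, h1, h2⟩ := exists_simultaneous_diagonalization (Kmin_posSemidef n) hs
  have hdet : M.det ≠ 0 := fun h => by
    have := det_sq_mul_prod h1
    rw [h] at this; norm_num at this
  have hπ : 0 < 2 * Real.pi := by positivity
  rw [norm_gsn hdet h1 h2, abs_det_eq hs h1]
  have h3 : ∀ k, √(2 * Real.pi) * (1 + l k ^ 2) ^ (-(1 / 4) : ℝ) *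
      Real.exp (-((Mᵀ *ᵥ x) k ^ 2 / (1 + l k ^ 2)) / 2) ≤
      √(2 * Real.pi) * Real.exp (-((Mᵀ *ᵥ x) k ^ 2 / (1 + l k ^ 2)) / 2) := fun k => by
    have : (1 + l k ^ 2) ^ (-(1 / 4) : ℝ) ≤ 1 :=
      Real.rpow_le_one_of_one_le_of_nonpos (by nlinarith [sq_nonneg (l k)]) (by norm_num)
    gcongr
    exact mul_le_of_le_one_right (Real.sqrt_nonneg _) this
  calc ((2 * Real.pi) ^ n)⁻¹ * ((∏ j, (√(s j))⁻¹) * ∏ k, (√(2 * Real.pi) *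
        (1 + l k ^ 2) ^ (-(1 / 4) : ℝ) * Real.exp (-((Mᵀ *ᵥ x) k ^ 2 / (1 + l k ^ 2)) / 2)))
      ≤ ((2 * Real.pi) ^ n)⁻¹ * ((∏ j, (√(s j))⁻¹) * ∏ k, (√(2 * Real.pi) *
        Real.exp (-((Mᵀ *ᵥ x) k ^ 2 / (1 + l k ^ 2)) / 2))) := by
        have h4 : 0 ≤ ∏ j, (√(s j))⁻¹ := Finset.prod_nonneg fun i _ => by positivity
        have h5 := Finset.prod_le_prod (s := Finset.univ) (fun k _ => by positivity)
          (fun k _ => h3 k)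
        gcongr
    _ = (∏ j : Fin n, (√(2 * Real.pi * s j))⁻¹) *
        Real.exp (-(∑ k, (Mᵀ *ᵥ x) k ^ 2 / (1 + l k ^ 2)) / 2) := by
        rw [Finset.prod_mul_distrib, ← Real.exp_sum]
        simp_rw [Real.sqrt_mul hπ.le, mul_inv, Finset.prod_mul_distrib]
        simp only [Finset.prod_const, Finset.card_univ, Fintype.card_fin, neg_div,
          Finset.sum_neg_distrib, Finset.sum_div]
        have : (2 * Real.pi) ^ n = √(2 * Real.pi) ^ n * √(2 * Real.pi) ^ n := by
          rw [← mul_pow, Real.mul_self_sqrt hπ.le]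
        rw [this, inv_pow]
        have : √(2 * Real.pi) ^ n ≠ 0 := by positivity
        field_simp
    _ ≤ (∏ j : Fin n, (√(2 * Real.pi * s j))⁻¹) *
        Real.exp (-(∑ j, x j ^ 2 / (s j + d j)) / 2) := by
        have := sum_div_le_sum_of_form_le hs hd h1 h2 hK x
        have h4 : 0 ≤ ∏ j : Fin n, (√(2 * Real.pi * s j))⁻¹ :=
          Finset.prod_nonneg fun i _ => by positivity
        gcongr
    _ = _ := by
        rw [Finset.prod_mul_distrib, ← Real.exp_sum]
        simp only [neg_div, Finset.sum_neg_distrib, Finset.sum_div]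

/-- The total variation of a complex Gaussian measure is bounded by a product. -/
lemma lintegral_norm_gsn_le {n : ℕ} {s : Fin n → ℝ} (hs : ∀ i, 0 < s i) :
    ∫⁻ x, ‖gsn n s x‖ₑ ≤ ∏ j : Fin n, ENNReal.ofReal (√(1 + ((j : ℕ) + 1) / s j)) := by
  obtain ⟨M, l, hl, h1, h2⟩ := exists_simultaneous_diagonalization (Kmin_posSemidef n) hs
  have hdet : M.det ≠ 0 := fun h => by
    have := det_sq_mul_prod h1
    rw [h] at this; norm_num at this
  have hπ : 0 < 2 * Real.pi := by positivity
  set h : Fin n → ℝ → ℝ := fun k t => √(2 * Real.pi) *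
      (1 + l k ^ 2) ^ (-(1 / 4) : ℝ) * Real.exp (-(t ^ 2 / (1 + l k ^ 2)) / 2) with hh
  have hhe : ∀ k t, Real.exp (-(t ^ 2 / (1 + l k ^ 2)) / 2) =
      Real.exp (-(1 / (2 * (1 + l k ^ 2))) * t ^ 2) := fun k t => by
    congr 1; field_simp
  have hint : ∀ k, Integrable (h k) := fun k => by
    simp only [hh, hhe]
    exact (integrable_exp_neg_mul_sq (by positivity)).const_mul _
  have hval : ∀ k, ∫ t, h k t = 2 * Real.pi * (1 + l k ^ 2) ^ (1 / 4 : ℝ) := fun k => by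
    have hlk : 0 < 1 + l k ^ 2 := by positivity
    simp only [hh, hhe]
    rw [integral_const_mul, integral_gaussian]
    have : Real.pi / (1 / (2 * (1 + l k ^ 2))) = 2 * Real.pi * (1 + l k ^ 2) := by field_simp
    rw [this, Real.sqrt_mul hπ.le, Real.sqrt_eq_rpow (1 + l k ^ 2)]
    have h5 : (1 + l k ^ 2) ^ (-(1 / 4) : ℝ) * (1 + l k ^ 2) ^ (1 / 2 : ℝ) =
        (1 + l k ^ 2) ^ (1 / 4 : ℝ) := by
      rw [← Real.rpow_add hlk]; norm_num
    have h6 := Real.mul_self_sqrt hπ.le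
    linear_combination (√(2 * Real.pi) * √(2 * Real.pi)) * h5 + (1 + l k ^ 2) ^ (1 / 4 : ℝ) * h6
  have hnn : ∀ k t, 0 ≤ h k t := fun k t => by simp only [hh]; positivity
  set f : (Fin n → ℝ) → ℝ := fun y => ((2 * Real.pi) ^ n)⁻¹ * (|M.det| * ∏ k, h k (y k)) with hf
  have hfm : Measurable fun y => ENNReal.ofReal (f y) := by
    apply ENNReal.measurable_ofReal.comp
    simp only [hf, hh]
    fun_prop
  have hfint : Integrable f :=
    ((Integrable.fintype_prod (f := h) hint).const_mul _).const_mul _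
  have hfval : ∫ y, f y = |M.det| * ∏ k, (1 + l k ^ 2) ^ (1 / 4 : ℝ) := by
    simp only [hf]
    rw [integral_const_mul, integral_const_mul, integral_fintype_prod_volume_eq_prod h]
    simp_rw [hval]
    rw [Finset.prod_mul_distrib]
    simp only [Finset.prod_const, Finset.card_univ, Fintype.card_fin]
    field_simp
  have hHad : ∏ k, (1 + l k) ≤ ∏ j : Fin n, (1 + ((j : ℕ) + 1) / s j) := by
    have hpsd : (diagonal s + Kmin n).PosSemidef :=
      (PosSemidef.diagonal fun i => (hs i).le).add (Kmin_posSemidef n)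
    have hdiag : ∀ i : Fin n, (diagonal s + Kmin n) i i = s i + ((i : ℕ) + 1) := fun i => by
      simp [Kmin]
    have h3 := hpsd.det_le_prod_diag fun i => by
      rw [hdiag]; have := hs i; positivity
    simp_rw [hdiag] at h3
    have h4 : ∏ k, (1 + l k) = M.det ^ 2 * (diagonal s + Kmin n).det := by
      have : Mᵀ * (diagonal s + Kmin n) * M = diagonal fun k => 1 + l k := by
        rw [Matrix.mul_add, Matrix.add_mul, h1, h2, ← diagonal_one, diagonal_add]
      have := congrArg Matrix.det this
      rw [det_mul, det_mul, det_transpose, det_diagonal] at this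
      linarith
    have h5 := det_sq_mul_prod h1
    have hps : 0 < ∏ j, s j := Finset.prod_pos fun i _ => hs i
    have h6 : ∏ j : Fin n, (1 + ((j : ℕ) + 1) / s j) =
        (∏ j : Fin n, (s j + ((j : ℕ) + 1))) / ∏ j, s j := by
      rw [← Finset.prod_div_distrib]
      refine Finset.prod_congr rfl fun j _ => ?_
      have := (hs j).ne'
      field_simp
    rw [h4, h6, le_div_iff₀ hps]
    calc M.det ^ 2 * (diagonal s + Kmin n).det * ∏ j, s j
        = (diagonal s + Kmin n).det := by linear_combination (diagonal s + Kmin n).det * h5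
      _ ≤ _ := h3
  calc ∫⁻ x, ‖gsn n s x‖ₑ = ∫⁻ x, ENNReal.ofReal (f (Mᵀ *ᵥ x)) := by
        refine lintegral_congr fun x => ?_
        rw [← ofReal_norm, norm_gsn hdet h1 h2]
    _ = ENNReal.ofReal |M.det|⁻¹ * ENNReal.ofReal (∫ y, f y) := by
        rw [lintegral_comp_mulVec (by rwa [det_transpose]) hfm, det_transpose,
          ofReal_integral_eq_lintegral_ofReal hfint]
        exact Filter.Eventually.of_forall fun y => by
          simp only [hf, Pi.zero_apply]
          have := Finset.prod_nonneg (s := Finset.univ) fun k _ => hnn k (y k)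
          positivity
    _ = ENNReal.ofReal (∏ k, (1 + l k ^ 2) ^ (1 / 4 : ℝ)) := by
        rw [← ENNReal.ofReal_mul (by positivity), hfval, ← mul_assoc,
          inv_mul_cancel₀ (abs_ne_zero.2 hdet), one_mul]
    _ ≤ ENNReal.ofReal (∏ j : Fin n, √(1 + ((j : ℕ) + 1) / s j)) := by
        apply ENNReal.ofReal_le_ofReal
        calc ∏ k, (1 + l k ^ 2) ^ (1 / 4 : ℝ) ≤ ∏ k, √(1 + l k) := by
              refine Finset.prod_le_prod (fun k _ => by positivity) fun k _ => ?_
              have hk := hl k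
              have : √(1 + l k) = ((1 + l k) ^ 2) ^ (1 / 4 : ℝ) := by
                rw [Real.sqrt_eq_rpow, ← Real.rpow_natCast, ← Real.rpow_mul (by positivity)]
                norm_num
              rw [this]
              exact Real.rpow_le_rpow (by positivity) (by nlinarith) (by norm_num)
          _ = √(∏ k, (1 + l k)) := by
              rw [Real.sqrt_eq_rpow, ← Real.finsetProd_rpow _ _ fun k _ => by
                have := hl k; positivity]
              simp_rw [Real.sqrt_eq_rpow]
          _ ≤ √(∏ j : Fin n, (1 + ((j : ℕ) + 1) / s j)) := Real.sqrt_le_sqrt hHad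
          _ = _ := by
              rw [Real.sqrt_eq_rpow, ← Real.finsetProd_rpow _ _ fun k _ => by
                have := hs k; positivity]
              simp_rw [Real.sqrt_eq_rpow]
    _ = _ := ENNReal.ofReal_prod_of_nonneg fun j _ => Real.sqrt_nonneg _

lemma norm_gsn_integrand (n : ℕ) (s x ξ : Fin n → ℝ) :
    ‖Complex.exp (-(∑ j : Fin n, ∑ k : Fin n, Amat n s j k * (ξ j : ℂ) * (ξ k : ℂ)) / 2
        - Complex.I * (∑ j : Fin n, (ξ j : ℂ) * (x j : ℂ)))‖ =
      ∏ j, Real.exp (-(s j / 2) * ξ j ^ 2) := by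
  have h : ∑ j : Fin n, (ξ j : ℂ) * (x j : ℂ) = ((∑ j, ξ j * x j : ℝ) : ℂ) := by push_cast; rfl
  rw [Complex.norm_exp, sum_Amat_eq, h, ← Real.exp_sum]
  congr 1
  simp only [neg_add_rev, Complex.sub_re, Complex.div_ofNat_re, Complex.add_re, Complex.neg_re,
    Complex.mul_re, Complex.I_re, Complex.ofReal_re, Complex.I_im, Complex.ofReal_im]
  simp only [dotProduct, mulVec_diagonal, zero_mul, mul_zero, sub_zero, neg_zero, zero_add,
    Finset.sum_div, ← Finset.sum_neg_distrib]
  refine Finset.sum_congr rfl fun j _ => ?_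
  ring

lemma integrable_prod_gaussian {n : ℕ} {s : Fin n → ℝ} (hs : ∀ i, 0 < s i) :
    Integrable fun ξ : Fin n → ℝ => ∏ j, Real.exp (-(s j / 2) * ξ j ^ 2) :=
  Integrable.fintype_prod (f := fun j t => Real.exp (-(s j / 2) * t ^ 2))
    fun j => integrable_exp_neg_mul_sq (half_pos (hs j))

lemma integrable_gsn_integrand {n : ℕ} {s : Fin n → ℝ} (hs : ∀ i, 0 < s i) (x : Fin n → ℝ) :
    Integrable fun ξ : Fin n → ℝ =>
      Complex.exp (-(∑ j : Fin n, ∑ k : Fin n, Amat n s j k * (ξ j : ℂ) * (ξ k : ℂ)) / 2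
        - Complex.I * (∑ j : Fin n, (ξ j : ℂ) * (x j : ℂ))) := by
  rw [← integrable_norm_iff (continuous_gsn_integrand n s x).aestronglyMeasurable]
  simp_rw [norm_gsn_integrand]
  exact integrable_prod_gaussian hs

lemma stronglyMeasurable_gsn (n : ℕ) :
    StronglyMeasurable fun p : (Fin n → ℝ) × (Fin n → ℝ) => gsn n p.1 p.2 := by
  have h : StronglyMeasurable fun p : (Fin n → ℝ) × (Fin n → ℝ) => ∫ ξ : Fin n → ℝ,
      Complex.exp (-(∑ j : Fin n, ∑ k : Fin n, Amat n p.1 j k * (ξ j : ℂ) * (ξ k : ℂ)) / 2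
        - Complex.I * (∑ j : Fin n, (ξ j : ℂ) * (p.2 j : ℂ))) := by
    refine StronglyMeasurable.integral_prod_right
      (f := fun (p : (Fin n → ℝ) × (Fin n → ℝ)) (ξ : Fin n → ℝ) =>
        Complex.exp (-(∑ j : Fin n, ∑ k : Fin n, Amat n p.1 j k * (ξ j : ℂ) * (ξ k : ℂ)) / 2
          - Complex.I * (∑ j : Fin n, (ξ j : ℂ) * (p.2 j : ℂ)))) ?_
    apply Continuous.stronglyMeasurable
    simp_rw [sum_Amat_eq]
    simp only [dotProduct, mulVec]
    fun_prop
  exact h.const_smul ((2 * Real.pi) ^ n : ℝ)⁻¹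

lemma volume_preserving_snoc (n : ℕ) :
    MeasurePreserving (fun p : ℝ × (Fin n → ℝ) => (Fin.snoc p.2 p.1 : Fin (n + 1) → ℝ)) := by
  have := (volume_preserving_piFinSuccAbove (fun _ : Fin (n + 1) => ℝ) (Fin.last n)).symm
  convert this using 1
  ext p : 1
  exact (Fin.insertNth_last (α := fun _ => ℝ) p.1 p.2).symm

lemma measurableEmbedding_snoc (n : ℕ) : MeasurableEmbedding
    (fun p : ℝ × (Fin n → ℝ) => (Fin.snoc p.2 p.1 : Fin (n + 1) → ℝ)) := by
  have := (MeasurableEquiv.piFinSuccAbove (fun _ : Fin (n + 1) => ℝ)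
    (Fin.last n)).symm.measurableEmbedding
  convert this using 1
  ext p : 1
  exact (Fin.insertNth_last (α := fun _ => ℝ) p.1 p.2).symm

lemma Amat_castSucc (n : ℕ) (s : Fin (n + 1) → ℝ) (j k : Fin n) :
    Amat (n + 1) s j.castSucc k.castSucc = Amat n (Fin.init s) j k := by
  simp [Amat, Kmin, diagonal_apply, Fin.init]

lemma continuous_snoc_left {n : ℕ} (x : Fin n → ℝ) :
    Continuous fun t : ℝ => (Fin.snoc x t : Fin (n + 1) → ℝ) :=
  continuous_const.finSnoc continuous_id

/-- Integrating out the last variable of a complex Gaussian gives the complex Gaussian in one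
dimension less. -/
lemma integral_gsn_snoc {n : ℕ} {s : Fin (n + 1) → ℝ} (hs : ∀ i, 0 < s i) (x : Fin n → ℝ)
    (hint : Integrable fun t : ℝ => gsn (n + 1) s (Fin.snoc x t)) :
    ∫ t : ℝ, gsn (n + 1) s (Fin.snoc x t) = gsn n (Fin.init s) x := by
  have hπ : 0 < 2 * Real.pi := by positivity
  set F : (Fin (n + 1) → ℝ) → ℂ := fun ξ =>
    Complex.exp (-(∑ j, ∑ k, Amat (n + 1) s j k * (ξ j : ℂ) * (ξ k : ℂ)) / 2
        - Complex.I * (∑ j, (ξ j : ℂ) * ((Fin.snoc x 0 : Fin (n + 1) → ℝ) j : ℂ))) with hF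
  have hFint : Integrable fun p : ℝ × (Fin n → ℝ) => F (Fin.snoc p.2 p.1) :=
    (volume_preserving_snoc n).integrable_comp_of_integrable (integrable_gsn_integrand hs _)
  have hFc : Continuous F := continuous_gsn_integrand _ _ _
  have hFn : ∀ (η : ℝ) (ξ : Fin n → ℝ), ‖F (Fin.snoc ξ η)‖ ≤
      ∏ j : Fin n, Real.exp (-(s j.castSucc / 2) * ξ j ^ 2) := fun η ξ => by
    simp only [hF]
    rw [norm_gsn_integrand, Fin.prod_univ_castSucc]
    simp only [Fin.snoc_castSucc, Fin.snoc_last]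
    refine mul_le_of_le_one_right (Finset.prod_nonneg fun _ _ => (Real.exp_pos _).le) ?_
    rw [Real.exp_le_one_iff]
    nlinarith [mul_nonneg (hs (Fin.last n)).le (sq_nonneg η)]
  set G : ℝ → ℂ := fun η => (((2 * Real.pi) ^ n : ℝ)⁻¹ : ℝ) • ∫ ξ : Fin n → ℝ, F (Fin.snoc ξ η)
    with hG
  have hGint : Integrable G := by
    have h : Integrable fun η : ℝ => ∫ ξ : Fin n → ℝ, F (Fin.snoc ξ η) := hFint.integral_prod_left
    exact h.smul ((2 * Real.pi) ^ n : ℝ)⁻¹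
  have hGc : Continuous G := by
    suffices h : Continuous fun η : ℝ => ∫ ξ : Fin n → ℝ, F (Fin.snoc ξ η) from
      h.const_smul ((2 * Real.pi) ^ n : ℝ)⁻¹
    refine continuous_of_dominated (bound := fun ξ : Fin n → ℝ =>
      ∏ j : Fin n, Real.exp (-(s j.castSucc / 2) * ξ j ^ 2)) ?_ ?_ ?_ ?_
    · intro η
      exact (hFc.comp (continuous_id.finSnoc continuous_const)).aestronglyMeasurable
    · exact fun η => Filter.Eventually.of_forall fun ξ => hFn η ξ
    · exact integrable_prod_gaussian fun j => hs j.castSucc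
    · exact Filter.Eventually.of_forall fun ξ => hFc.comp (continuous_snoc_left ξ)
  have hgF : ∀ t : ℝ, gsn (n + 1) s (Fin.snoc x t) =
      ((2 * Real.pi)⁻¹ : ℝ) • FourierTransform.fourier G (t / (2 * Real.pi)) := fun t => by
    have h1 : ∀ ξ : Fin (n + 1) → ℝ,
        Complex.exp (-(∑ j, ∑ k, Amat (n + 1) s j k * (ξ j : ℂ) * (ξ k : ℂ)) / 2
          - Complex.I * (∑ j, (ξ j : ℂ) * ((Fin.snoc x t : Fin (n + 1) → ℝ) j : ℂ))) =
        Complex.exp (-(Complex.I * (ξ (Fin.last n) * t))) * F ξ := fun ξ => by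
      simp only [hF]
      rw [← Complex.exp_add]
      congr 1
      simp only [Fin.sum_univ_castSucc (fun j => (ξ j : ℂ) * _), Fin.snoc_castSucc, Fin.snoc_last,
        Complex.ofReal_zero]
      ring
    have h2 : Integrable fun p : ℝ × (Fin n → ℝ) =>
        Complex.exp (-(Complex.I * (p.1 * t))) * F (Fin.snoc p.2 p.1) := by
      refine hFint.bdd_mul (c := 1) (by fun_prop) (Filter.Eventually.of_forall fun p => ?_)
      rw [Complex.norm_exp]; simp
    rw [gsn]
    simp_rw [h1]
    rw [← (volume_preserving_snoc n).integral_comp (measurableEmbedding_snoc n)]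
    simp only [Fin.snoc_last]
    rw [Measure.volume_eq_prod, integral_prod _ h2, Real.fourier_eq, pow_succ, mul_inv, mul_comm,
      ← smul_smul]
    congr 1
    rw [← integral_smul]
    refine integral_congr_ae (Filter.Eventually.of_forall fun η => ?_)
    simp only [hG]
    rw [integral_const_mul, Circle.smul_def, Real.fourierChar_apply, smul_comm, smul_eq_mul]
    congr 3
    simp only [RCLike.inner_apply, conj_trivial]
    push_cast
    have : (Real.pi : ℂ) ≠ 0 := by exact_mod_cast Real.pi_ne_zero
    field_simp
  have hFG : Integrable (FourierTransform.fourier G) := by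
    have h3 : Integrable fun t : ℝ => FourierTransform.fourier G (t / (2 * Real.pi)) := by
      have := hint.smul (2 * Real.pi)
      refine this.congr (Filter.Eventually.of_forall fun t => ?_)
      simp only [Pi.smul_apply, hgF, smul_smul, mul_inv_cancel₀ hπ.ne', one_smul]
    exact (integrable_comp_div_iff _ hπ.ne').1 h3
  have hinv := hGint.fourierInv_fourier_eq hFG (v := 0) hGc.continuousAt
  rw [Real.fourierInv_eq] at hinv
  simp only [inner_zero_right, AddChar.map_zero_eq_one, one_smul] at hinv
  have hG0 : G 0 = gsn n (Fin.init s) x := by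
    simp only [hG, hF, gsn]
    congr 1
    refine integral_congr_ae (Filter.Eventually.of_forall fun ξ => ?_)
    simp only [Fin.sum_univ_castSucc, Fin.snoc_castSucc, Fin.snoc_last, Amat_castSucc]
    simp
  simp_rw [hgF]
  rw [integral_smul, Measure.integral_comp_div, hinv, abs_of_pos hπ, smul_smul,
    inv_mul_cancel₀ hπ.ne', one_smul, hG0]

lemma sum_Kmin_mulVec_sq_div_le {n : ℕ} {s : Fin n → ℝ} (hs : ∀ i, 0 < s i) {W T ε : ℝ}
    (hε : 0 ≤ ε) (hW : ∑ j : Fin n, ((j : ℕ) + 1 : ℝ) ^ (-(1 + ε)) ≤ W)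
    (hT : ∑ i : Fin n, ((i : ℕ) + 1 : ℝ) ^ (3 / 2 + ε) / s i ≤ T) (ζ : Fin n → ℝ) :
    ∑ i, (Kmin n *ᵥ ζ) i ^ 2 / s i
      ≤ ∑ j : Fin n, (W * T * ((j : ℕ) + 1 : ℝ) ^ (3 / 2 + ε)) * ζ j ^ 2 := by
  have hpos : ∀ (j : Fin n) (r : ℝ), 0 < ((j : ℕ) + 1 : ℝ) ^ r := fun j r =>
    Real.rpow_pos_of_pos (by positivity) r
  set S : ℝ := ∑ j : Fin n, ((j : ℕ) + 1 : ℝ) ^ (3 / 2 + ε) * ζ j ^ 2 with hS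
  have hS0 : 0 ≤ S := Finset.sum_nonneg fun j _ => mul_nonneg (hpos j _).le (sq_nonneg _)
  have hW0 : 0 ≤ W := le_trans (Finset.sum_nonneg fun j _ => (hpos j _).le) hW
  have hrow : ∀ i : Fin n, (Kmin n *ᵥ ζ) i ^ 2 ≤ W * (((i : ℕ) + 1 : ℝ) ^ (3 / 2 + ε) * S) := by
    intro i
    have hcs := Finset.sum_sq_le_sum_mul_sum_of_sq_le_mul Finset.univ
      (r := fun j => Kmin n i j * ζ j)
      (f := fun j : Fin n => ((j : ℕ) + 1 : ℝ) ^ (-(1 + ε)))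
      (g := fun j : Fin n => ((i : ℕ) + 1 : ℝ) ^ (3 / 2 + ε)
        * (((j : ℕ) + 1 : ℝ) ^ (3 / 2 + ε) * ζ j ^ 2))
      (fun j _ => (hpos j _).le)
      (fun j _ => mul_nonneg (hpos i _).le (mul_nonneg (hpos j _).le (sq_nonneg _)))
      (fun j _ => by
        have h1 : ((j : ℕ) + 1 : ℝ) ^ (-(1 + ε)) * ((j : ℕ) + 1 : ℝ) ^ (3 / 2 + ε)
            = ((j : ℕ) + 1 : ℝ) ^ (1 / 2 : ℝ) := by
          rw [← Real.rpow_add (by positivity)]; congr 1; ring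
        have hK : Kmin n i j ^ 2
            ≤ ((i : ℕ) + 1 : ℝ) ^ (3 / 2 + ε) * ((j : ℕ) + 1 : ℝ) ^ (1 / 2 : ℝ) := by
          have e : Kmin n i j = min ((i : ℕ) + 1 : ℝ) ((j : ℕ) + 1 : ℝ) := by
            simp [Kmin, min_add_add_right]
          have hm0 : 0 < min ((i : ℕ) + 1 : ℝ) ((j : ℕ) + 1 : ℝ) := by positivity
          rw [e, ← Real.rpow_natCast]
          calc min ((i : ℕ) + 1 : ℝ) ((j : ℕ) + 1 : ℝ) ^ ((2 : ℕ) : ℝ)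
              = min ((i : ℕ) + 1 : ℝ) ((j : ℕ) + 1 : ℝ) ^ (3 / 2 : ℝ)
                * min ((i : ℕ) + 1 : ℝ) ((j : ℕ) + 1 : ℝ) ^ (1 / 2 : ℝ) := by
                rw [← Real.rpow_add hm0]; norm_num
            _ ≤ ((i : ℕ) + 1 : ℝ) ^ (3 / 2 : ℝ) * ((j : ℕ) + 1 : ℝ) ^ (1 / 2 : ℝ) := by
                gcongr
                · exact min_le_left _ _
                · exact min_le_right _ _
            _ ≤ _ := by
                gcongr
                · linarith [Nat.cast_nonneg (α := ℝ) (i : ℕ)]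
                · linarith
        calc (Kmin n i j * ζ j) ^ 2 = Kmin n i j ^ 2 * ζ j ^ 2 := by ring
          _ ≤ _ := mul_le_mul_of_nonneg_right hK (sq_nonneg _)
          _ = _ := by rw [← h1]; ring)
    rw [← Finset.mul_sum] at hcs
    calc (Kmin n *ᵥ ζ) i ^ 2 = (∑ j, Kmin n i j * ζ j) ^ 2 := rfl
      _ ≤ _ := hcs
      _ ≤ _ := mul_le_mul_of_nonneg_right hW (mul_nonneg (hpos i _).le hS0)
  calc ∑ i, (Kmin n *ᵥ ζ) i ^ 2 / s i
      ≤ ∑ i : Fin n, (W * S) * (((i : ℕ) + 1 : ℝ) ^ (3 / 2 + ε) / s i) := by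
        refine Finset.sum_le_sum fun i _ => ?_
        calc _ ≤ _ := div_le_div_of_nonneg_right (hrow i) (hs i).le
          _ = _ := by ring
    _ = (W * S) * ∑ i : Fin n, ((i : ℕ) + 1 : ℝ) ^ (3 / 2 + ε) / s i :=
        (Finset.mul_sum _ _ _).symm
    _ ≤ (W * S) * T := mul_le_mul_of_nonneg_left hT (mul_nonneg hW0 hS0)
    _ = _ := by
        rw [hS, Finset.mul_sum, Finset.sum_mul]
        exact Finset.sum_congr rfl fun j _ => by ring

/-- Pointwise domination of `gsn` by a product of Gaussian densities, with a constant that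
does not depend on `n`. -/
lemma norm_gsn_le_prod_gaussianPDFReal {n : ℕ} {s : Fin n → ℝ} (hs : ∀ i, 0 < s i) {W T ε : ℝ}
    (hε : 0 ≤ ε) (hW : ∑ j : Fin n, ((j : ℕ) + 1 : ℝ) ^ (-(1 + ε)) ≤ W)
    (hT : ∑ i : Fin n, ((i : ℕ) + 1 : ℝ) ^ (3 / 2 + ε) / s i ≤ T) {v : Fin n → NNReal}
    (hv : ∀ j : Fin n, (v j : ℝ) = s j + W * T * ((j : ℕ) + 1 : ℝ) ^ (3 / 2 + ε))
    (x : Fin n → ℝ) :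
    ‖gsn n s x‖ ≤ Real.exp (W * T * T / 2)
      * ∏ j, ProbabilityTheory.gaussianPDFReal 0 (v j) (x j) := by
  have hpos : ∀ (j : Fin n) (r : ℝ), 0 < ((j : ℕ) + 1 : ℝ) ^ r := fun j r =>
    Real.rpow_pos_of_pos (by positivity) r
  have hW0 : 0 ≤ W := le_trans (Finset.sum_nonneg fun j _ => (hpos j _).le) hW
  have hT0 : 0 ≤ T :=
    le_trans (Finset.sum_nonneg fun j _ => (div_pos (hpos j _) (hs j)).le) hT
  have hd : ∀ j : Fin n, 0 ≤ W * T * ((j : ℕ) + 1 : ℝ) ^ (3 / 2 + ε) := fun j =>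
    mul_nonneg (mul_nonneg hW0 hT0) (hpos j _).le
  have hv0 : ∀ j, 0 < (v j : ℝ) := fun j => by rw [hv j]; linarith [hs j, hd j]
  refine (norm_gsn_le hs hd (sum_Kmin_mulVec_sq_div_le hs hε hW hT) x).trans ?_
  calc _ ≤ ∏ j : Fin n, (Real.exp (W * T * (((j : ℕ) + 1 : ℝ) ^ (3 / 2 + ε) / s j) / 2)
          * ProbabilityTheory.gaussianPDFReal 0 (v j) (x j)) := by
        refine Finset.prod_le_prod (fun j _ => by positivity) fun j _ => ?_
        rw [ProbabilityTheory.gaussianPDFReal, ← hv j, ← mul_assoc]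
        have e1 : -(x j ^ 2 / (v j : ℝ)) / 2 = -(x j - 0) ^ 2 / (2 * (v j : ℝ)) := by
          have := (hv0 j).ne'
          field_simp; ring
        rw [e1]
        refine mul_le_mul_of_nonneg_right ?_ (Real.exp_pos _).le
        have hsj := hs j
        have hvj := hv0 j
        have h2 : √(2 * Real.pi * v j) ≤
            Real.exp (W * T * (((j : ℕ) + 1 : ℝ) ^ (3 / 2 + ε) / s j) / 2)
              * √(2 * Real.pi * s j) := by
          rw [show Real.exp (W * T * (((j : ℕ) + 1 : ℝ) ^ (3 / 2 + ε) / s j) / 2)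
            = √(Real.exp (W * T * (((j : ℕ) + 1 : ℝ) ^ (3 / 2 + ε) / s j))) from Real.exp_half _,
            ← Real.sqrt_mul (Real.exp_pos _).le]
          refine Real.sqrt_le_sqrt ?_
          have h3 := Real.add_one_le_exp (W * T * (((j : ℕ) + 1 : ℝ) ^ (3 / 2 + ε) / s j))
          have h4 : (v j : ℝ) = (W * T * (((j : ℕ) + 1 : ℝ) ^ (3 / 2 + ε) / s j) + 1) * s j := by
            rw [hv j]; field_simp; ring
          calc 2 * Real.pi * (v j : ℝ)
              = (W * T * (((j : ℕ) + 1 : ℝ) ^ (3 / 2 + ε) / s j) + 1)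
                * (2 * Real.pi * s j) := by rw [h4]; ring
            _ ≤ _ := mul_le_mul_of_nonneg_right h3 (by positivity)
        rw [inv_le_iff_one_le_mul₀ (by positivity)]
        rw [mul_right_comm, ← div_eq_mul_inv, one_le_div (by positivity)]
        exact h2
    _ = Real.exp (∑ j : Fin n, W * T * (((j : ℕ) + 1 : ℝ) ^ (3 / 2 + ε) / s j) / 2)
          * ∏ j, ProbabilityTheory.gaussianPDFReal 0 (v j) (x j) := by
        rw [Finset.prod_mul_distrib, Real.exp_sum]
    _ ≤ _ := by
        refine mul_le_mul_of_nonneg_right (Real.exp_le_exp.2 ?_)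
          (Finset.prod_nonneg fun j _ => ProbabilityTheory.gaussianPDFReal_nonneg _ _ _)
        rw [← Finset.sum_div, ← Finset.mul_sum]
        gcongr

section Tower

open ProbabilityTheory Filter Topology

/-- The first `n` coordinates of a sequence. -/
def firstCoords (n : ℕ) (x : ℕ → ℝ) : Fin n → ℝ := fun i => x i

@[fun_prop]
lemma measurable_firstCoords (n : ℕ) : Measurable (firstCoords n) :=
  measurable_pi_lambda _ fun i => measurable_pi_apply (i : ℕ)

lemma measurePreserving_firstCoords (μ : ℕ → Measure ℝ) [∀ i, IsProbabilityMeasure (μ i)]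
    (n : ℕ) : MeasurePreserving (firstCoords n) (Measure.infinitePi μ)
      (Measure.pi fun i : Fin n => μ i) := by
  refine ⟨measurable_firstCoords n, (Measure.pi_eq fun s hs => ?_).symm⟩
  rw [Measure.map_apply (measurable_firstCoords n) (MeasurableSet.univ_pi hs)]
  have : firstCoords n ⁻¹' Set.pi univ s = Set.pi (Finset.range n : Set ℕ)
      (fun i => if h : i < n then s ⟨i, h⟩ else univ) := by
    ext x
    simp only [firstCoords, mem_preimage, Set.mem_pi, mem_univ, true_implies, Finset.mem_coe,
      Finset.mem_range, Fin.forall_iff]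
    exact forall₂_congr fun i hi => by simp [hi]
  rw [this, Measure.infinitePi_pi, Finset.prod_range]
  · simp
  · intro i hi
    simp only [Finset.mem_range] at hi
    simp [hi, hs]

lemma measurePreserving_snoc (ν : Measure ℝ) [SigmaFinite ν] (n : ℕ) :
    MeasurePreserving (fun p : ℝ × (Fin n → ℝ) => (Fin.snoc p.2 p.1 : Fin (n + 1) → ℝ))
      (ν.prod (Measure.pi fun _ : Fin n => ν)) (Measure.pi fun _ : Fin (n + 1) => ν) := by
  have := (measurePreserving_piFinSuccAbove (fun _ : Fin (n + 1) => ν) (Fin.last n)).symm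
  convert this using 1
  ext p : 1
  exact (Fin.insertNth_last (α := fun _ => ℝ) p.1 p.2).symm

variable {ν : Measure ℝ} [IsProbabilityMeasure ν] {f : ∀ n, (Fin n → ℝ) → ℂ} {C : ℝ}

lemma setIntegral_firstCoords_succ (hf : ∀ n, StronglyMeasurable (f n))
    (hC : ∀ n x, ‖f n x‖ ≤ C) (hstep : ∀ n x, ∫ t, f (n + 1) (Fin.snoc x t) ∂ν = f n x)
    (n : ℕ) {E : Set (Fin n → ℝ)} (hE : MeasurableSet E) :
    ∫ z in firstCoords n ⁻¹' E, f (n + 1) (firstCoords (n + 1) z) ∂Measure.infinitePi (fun _ => ν)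
      = ∫ x in E, f n x ∂Measure.pi (fun _ : Fin n => ν) := by
  have hE' : MeasurableSet {y : Fin (n + 1) → ℝ | Fin.init y ∈ E} := by
    refine (measurable_pi_lambda _ fun i => measurable_pi_apply _ :
      Measurable fun y : Fin (n + 1) → ℝ => (Fin.init y : Fin n → ℝ)) hE
  have h1 : ∫ z in firstCoords n ⁻¹' E, f (n + 1) (firstCoords (n + 1) z)
        ∂Measure.infinitePi (fun _ => ν)
      = ∫ y in {y : Fin (n + 1) → ℝ | Fin.init y ∈ E}, f (n + 1) y
        ∂Measure.pi (fun _ : Fin (n + 1) => ν) := by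
    rw [← (measurePreserving_firstCoords (fun _ => ν) (n + 1)).map_eq,
      setIntegral_map hE' (hf _).aestronglyMeasurable (measurable_firstCoords _).aemeasurable]
    rfl
  rw [h1, ← (measurePreserving_snoc ν n).map_eq,
    setIntegral_map hE' (hf _).aestronglyMeasurable
      (measurePreserving_snoc ν n).measurable.aemeasurable]
  have h2 : (fun p : ℝ × (Fin n → ℝ) => (Fin.snoc p.2 p.1 : Fin (n + 1) → ℝ)) ⁻¹'
      {y : Fin (n + 1) → ℝ | Fin.init y ∈ E} = univ ×ˢ E := by
    ext p; simp
  have hint : Integrable (fun p : ℝ × (Fin n → ℝ) =>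
      f (n + 1) (Fin.snoc p.2 p.1 : Fin (n + 1) → ℝ)) (ν.prod (Measure.pi fun _ : Fin n => ν)) :=
    Integrable.of_bound ((hf _).comp_measurable
      (measurePreserving_snoc ν n).measurable).aestronglyMeasurable C
      (ae_of_all _ fun p => hC _ _)
  rw [h2, ← Measure.prod_restrict, Measure.restrict_univ, integral_prod_symm]
  swap
  · have := hint.integrableOn (s := univ ×ˢ E)
    rwa [IntegrableOn, ← Measure.prod_restrict, Measure.restrict_univ] at this
  exact setIntegral_congr_fun hE fun x _ => hstep n x

lemma setIntegral_firstCoords (hf : ∀ n, StronglyMeasurable (f n))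
    (n : ℕ) {E : Set (Fin n → ℝ)} (hE : MeasurableSet E) :
    ∫ z in firstCoords n ⁻¹' E, f n (firstCoords n z) ∂Measure.infinitePi (fun _ => ν)
      = ∫ x in E, f n x ∂Measure.pi (fun _ : Fin n => ν) := by
  rw [← (measurePreserving_firstCoords (fun _ => ν) n).map_eq,
      setIntegral_map hE (hf _).aestronglyMeasurable (measurable_firstCoords _).aemeasurable]

lemma setIntegral_firstCoords_of_le (hf : ∀ n, StronglyMeasurable (f n))
    (hC : ∀ n x, ‖f n x‖ ≤ C) (hstep : ∀ n x, ∫ t, f (n + 1) (Fin.snoc x t) ∂ν = f n x)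
    {n m : ℕ} (hnm : n ≤ m) {E : Set (Fin n → ℝ)} (hE : MeasurableSet E) :
    ∫ z in firstCoords n ⁻¹' E, f m (firstCoords m z) ∂Measure.infinitePi (fun _ => ν)
      = ∫ x in E, f n x ∂Measure.pi (fun _ : Fin n => ν) := by
  induction m, hnm using Nat.le_induction with
  | base => exact setIntegral_firstCoords hf n hE
  | succ m hnm ih =>
    have hE' : MeasurableSet {y : Fin m → ℝ | (fun i : Fin n => y (Fin.castLE hnm i)) ∈ E} :=
      (measurable_pi_lambda _ fun i => measurable_pi_apply _ :
        Measurable fun y : Fin m → ℝ => (fun i : Fin n => y (Fin.castLE hnm i))) hE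
    rw [← ih]
    exact (setIntegral_firstCoords_succ hf hC hstep m hE').trans
      (setIntegral_firstCoords (ν := ν) hf m hE').symm

/-- The filtration generated by the coordinates. -/
def coordFiltration : Filtration ℕ (inferInstance : MeasurableSpace (ℕ → ℝ)) where
  seq n := MeasurableSpace.comap (firstCoords n) inferInstance
  mono' n m hnm := by
    have : firstCoords n = (fun y : Fin m → ℝ => fun i : Fin n => y (Fin.castLE hnm i))
        ∘ firstCoords m := rfl
    show MeasurableSpace.comap (firstCoords n) _ ≤ _
    rw [this, ← MeasurableSpace.comap_comp]
    exact MeasurableSpace.comap_mono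
      (measurable_pi_lambda _ fun i => measurable_pi_apply _).comap_le
  le' n := (measurable_firstCoords n).comap_le

lemma ae_exists_tendsto_firstCoords (hf : ∀ n, StronglyMeasurable (f n))
    (hC : ∀ n x, ‖f n x‖ ≤ C) (hstep : ∀ n x, ∫ t, f (n + 1) (Fin.snoc x t) ∂ν = f n x) :
    ∀ᵐ z ∂Measure.infinitePi (fun _ : ℕ => ν),
      ∃ l, Tendsto (fun n => f n (firstCoords n z)) atTop (𝓝 l) := by
  have hint : ∀ n, Integrable (fun z => f n (firstCoords n z))
      (Measure.infinitePi (fun _ : ℕ => ν)) :=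
    fun n => Integrable.of_bound ((hf n).comp_measurable
      (measurable_firstCoords n)).aestronglyMeasurable C (ae_of_all _ fun z => hC _ _)
  have key : ∀ L : ℂ →L[ℝ] ℝ, ∀ᵐ z ∂Measure.infinitePi (fun _ : ℕ => ν),
      ∃ l, Tendsto (fun n => L (f n (firstCoords n z))) atTop (𝓝 l) := by
    intro L
    have hmart : Martingale (fun n z => L (f n (firstCoords n z))) coordFiltration
        (Measure.infinitePi (fun _ : ℕ => ν)) := by
      refine martingale_of_setIntegral_eq_succ (fun n => ?_)
        (fun n => L.integrable_comp (hint n)) ?_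
      · exact (L.continuous.comp_stronglyMeasurable (hf n)).comp_measurable
          (comap_measurable (firstCoords n))
      · rintro n _ ⟨E, hE, rfl⟩
        rw [L.integral_comp_comm (hint n).integrableOn,
          L.integral_comp_comm (hint (n + 1)).integrableOn,
          setIntegral_firstCoords_succ hf hC hstep n hE, setIntegral_firstCoords hf n hE]
    have hb : ∀ n, eLpNorm (fun z => L (f n (firstCoords n z))) 1
        (Measure.infinitePi (fun _ : ℕ => ν)) ≤ (Real.toNNReal (‖L‖ * C) : ENNReal) := by
      intro n
      refine (eLpNorm_le_of_ae_bound (C := ‖L‖ * C) (ae_of_all _ fun z => ?_)).trans ?_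
      · exact (L.le_opNorm _).trans (by gcongr; exact hC _ _)
      · simp only [measure_univ, ENNReal.one_rpow, one_mul]
        exact le_rfl
    filter_upwards [hmart.submartingale.ae_tendsto_limitProcess hb] with z hz using ⟨_, hz⟩
  filter_upwards [key Complex.reCLM, key Complex.imCLM] with z h1 h2
  obtain ⟨a, ha⟩ := h1
  obtain ⟨b, hb⟩ := h2
  refine ⟨⟨a, b⟩, ?_⟩
  have := Complex.equivRealProdCLM.symm.continuous.continuousAt.tendsto.comp (ha.prodMk_nhds hb)
  exact this

end Tower

section GaussianTransport

open ProbabilityTheory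

lemma pi_withDensity_ofReal {n : ℕ} {p : Fin n → ℝ → ℝ} (h0 : ∀ i x, 0 ≤ p i x)
    (hp : ∀ i, Integrable (p i)) :
    Measure.pi (fun i => volume.withDensity fun x => ENNReal.ofReal (p i x))
      = volume.withDensity fun x : Fin n → ℝ => ENNReal.ofReal (∏ i, p i (x i)) := by
  have : ∀ i, IsFiniteMeasure (volume.withDensity fun x => ENNReal.ofReal (p i x)) :=
    fun i => isFiniteMeasure_withDensity_ofReal (hp i).2
  refine Measure.pi_eq fun s hs => ?_
  have e : ∀ i, ∫⁻ x in s i, ENNReal.ofReal (p i x)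
      = ENNReal.ofReal (∫ x, (s i).indicator (p i) x) := by
    intro i
    rw [integral_indicator (hs i),
      ofReal_integral_eq_lintegral_ofReal (hp i).integrableOn (ae_of_all _ (h0 i))]
  have h0' : ∀ i x, 0 ≤ (s i).indicator (p i) x := fun i x =>
    indicator_nonneg (fun _ _ => h0 i _) x
  have hi : ∀ i, Integrable ((s i).indicator (p i)) := fun i => (hp i).indicator (hs i)
  have hI : Integrable (fun x : Fin n → ℝ => ∏ i, (s i).indicator (p i) (x i)) :=
    Integrable.fintype_prod hi
  simp only [withDensity_apply _ (MeasurableSet.univ_pi hs), withDensity_apply _ (hs _), e]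
  rw [← ENNReal.ofReal_prod_of_nonneg (fun i _ => integral_nonneg (h0' i)),
    ← integral_fintype_prod_volume_eq_prod, ofReal_integral_eq_lintegral_ofReal
      hI (ae_of_all _ fun x => Finset.prod_nonneg fun i _ => h0' i _),
    ← lintegral_indicator (MeasurableSet.univ_pi hs)]
  refine lintegral_congr fun x => ?_
  by_cases hx : x ∈ Set.pi univ s
  · rw [indicator_of_mem hx]
    congr 1
    exact Finset.prod_congr rfl fun i _ => (indicator_of_mem (hx i (mem_univ i)) _).symm
  · rw [indicator_of_notMem hx]
    simp only [Set.mem_pi, mem_univ, true_implies, not_forall] at hx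
    obtain ⟨i, hxi⟩ := hx
    rw [Finset.prod_eq_zero (Finset.mem_univ i) (indicator_of_notMem hxi _), ENNReal.ofReal_zero]

/-- Coordinatewise rescaling by standard deviations. -/
noncomputable def rescale {ι : Type*} (v : ι → NNReal) (z : ι → ℝ) : ι → ℝ :=
  fun j => √(v j : ℝ) * z j

lemma measurable_rescale {ι : Type*} (v : ι → NNReal) : Measurable (rescale v) :=
  measurable_pi_lambda _ fun j => (measurable_pi_apply j).const_mul _

lemma measurePreserving_sqrt_mul (v : NNReal) :
    MeasurePreserving (fun t => √(v : ℝ) * t) (gaussianReal 0 1) (gaussianReal 0 v) := by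
  refine ⟨measurable_const_mul _, ?_⟩
  rw [gaussianReal_map_const_mul]
  congr 1
  · simp
  · ext; simp

lemma measurePreserving_rescale {n : ℕ} {v : Fin n → NNReal} (hv : ∀ j, v j ≠ 0) :
    MeasurePreserving (rescale v) (Measure.pi fun _ : Fin n => gaussianReal 0 1)
      (volume.withDensity fun x : Fin n → ℝ =>
        ENNReal.ofReal (∏ j, gaussianPDFReal 0 (v j) (x j))) := by
  have h := measurePreserving_pi (fun _ : Fin n => gaussianReal 0 1)
    (fun j => gaussianReal 0 (v j)) (fun j => measurePreserving_sqrt_mul (v j))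
  have e : (Measure.pi fun j => gaussianReal 0 (v j))
      = volume.withDensity fun x : Fin n → ℝ =>
        ENNReal.ofReal (∏ j, gaussianPDFReal 0 (v j) (x j)) := by
    rw [← pi_withDensity_ofReal (fun j => gaussianPDFReal_nonneg _ _)
      (fun j => integrable_gaussianPDFReal _ _)]
    congr 1
    ext1 j
    rw [gaussianReal_of_var_ne_zero _ (hv j)]
    rfl
  rw [← e]
  exact h

/-- The density of `gsn` with respect to a product of Gaussian measures, in the
standardized coordinates. -/
noncomputable def normDens (n : ℕ) (s : Fin n → ℝ) (v : Fin n → NNReal) (z : Fin n → ℝ) : ℂ :=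
  (∏ j, gaussianPDFReal 0 (v j) (rescale v z j))⁻¹ • gsn n s (rescale v z)

variable {n : ℕ} {s : Fin n → ℝ} {v : Fin n → NNReal}

lemma measurable_prod_gaussianPDFReal :
    Measurable fun p : (Fin n → NNReal) × (Fin n → ℝ) =>
      ∏ j, gaussianPDFReal 0 (p.1 j) (p.2 j) := by
  unfold gaussianPDFReal
  fun_prop

lemma measurable_rescale_uncurry {ι : Type*} :
    Measurable fun p : (ι → NNReal) × (ι → ℝ) => rescale p.1 p.2 := by
  refine measurable_pi_lambda _ fun j => ?_
  unfold rescale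
  fun_prop

lemma stronglyMeasurable_normDens (n : ℕ) :
    StronglyMeasurable fun p : (Fin n → ℝ) × (Fin n → NNReal) × (Fin n → ℝ) =>
      normDens n p.1 p.2.1 p.2.2 := by
  unfold normDens
  have h1 : Measurable fun p : (Fin n → ℝ) × (Fin n → NNReal) × (Fin n → ℝ) =>
      rescale p.2.1 p.2.2 := measurable_rescale_uncurry.comp measurable_snd
  have h2 : StronglyMeasurable fun p : (Fin n → ℝ) × (Fin n → NNReal) × (Fin n → ℝ) =>
      (∏ j, gaussianPDFReal 0 (p.2.1 j) (rescale p.2.1 p.2.2 j))⁻¹ :=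
    (measurable_prod_gaussianPDFReal.comp
      ((measurable_fst.comp measurable_snd).prodMk h1)).inv.stronglyMeasurable
  have h3 := (stronglyMeasurable_gsn n).comp_measurable (measurable_fst.prodMk h1)
  simp only [Function.comp_def] at h3
  exact h2.smul h3

lemma prod_gaussianPDFReal_pos (hv : ∀ j, v j ≠ 0) (x : Fin n → ℝ) :
    0 < ∏ j, gaussianPDFReal 0 (v j) (x j) :=
  Finset.prod_pos fun j _ => gaussianPDFReal_pos _ _ _ (hv j)

lemma norm_normDens_le {C : ℝ} (hv : ∀ j, v j ≠ 0)
    (hC : ∀ x, ‖gsn n s x‖ ≤ C * ∏ j, gaussianPDFReal 0 (v j) (x j)) (z : Fin n → ℝ) :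
    ‖normDens n s v z‖ ≤ C := by
  have h := prod_gaussianPDFReal_pos hv (rescale v z)
  rw [normDens, norm_smul, norm_inv, Real.norm_of_nonneg h.le, inv_mul_le_iff₀ h, mul_comm]
  exact hC _

lemma stronglyMeasurable_gsn_right (n : ℕ) (s : Fin n → ℝ) : StronglyMeasurable (gsn n s) := by
  have h : Measurable fun x : Fin n → ℝ => (s, x) := measurable_prodMk_left
  have h' := (stronglyMeasurable_gsn n).comp_measurable h
  simp only [Function.comp_def] at h'
  exact h'

lemma measurable_prod_gaussianPDFReal_right (v : Fin n → NNReal) :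
    Measurable fun x : Fin n → ℝ => ∏ j, gaussianPDFReal 0 (v j) (x j) := by
  have h : Measurable fun x : Fin n → ℝ => (v, x) := measurable_prodMk_left
  exact measurable_prod_gaussianPDFReal.comp h

lemma setIntegral_normDens (hv : ∀ j, v j ≠ 0) {E : Set (Fin n → ℝ)} (hE : MeasurableSet E) :
    ∫ z in rescale v ⁻¹' E, normDens n s v z ∂Measure.pi (fun _ : Fin n => gaussianReal 0 1)
      = ∫ x in E, gsn n s x := by
  set q : (Fin n → ℝ) → ℝ := fun x => ∏ j, gaussianPDFReal 0 (v j) (x j) with hq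
  have hqm : Measurable q := measurable_prod_gaussianPDFReal_right v
  have hm : StronglyMeasurable fun x => (q x)⁻¹ • gsn n s x :=
    hqm.inv.stronglyMeasurable.smul (stronglyMeasurable_gsn_right n s)
  have h1 : ∫ z in rescale v ⁻¹' E, normDens n s v z ∂Measure.pi (fun _ : Fin n => gaussianReal 0 1)
      = ∫ x in E, (q x)⁻¹ • gsn n s x ∂(volume.withDensity fun x => ENNReal.ofReal (q x)) := by
    rw [← (measurePreserving_rescale hv).map_eq, setIntegral_map hE hm.aestronglyMeasurable
      (measurable_rescale v).aemeasurable]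
    rfl
  rw [h1, setIntegral_withDensity_eq_setIntegral_toReal_smul hqm.ennreal_ofReal
    (ae_of_all _ fun _ => ENNReal.ofReal_lt_top) _ hE]
  refine setIntegral_congr_fun hE fun x _ => ?_
  have h := prod_gaussianPDFReal_pos hv x
  simp only [ENNReal.toReal_ofReal h.le, hq]
  rw [smul_smul, mul_inv_cancel₀ h.ne', one_smul]

lemma lintegral_norm_normDens (hv : ∀ j, v j ≠ 0) :
    ∫⁻ z, ‖normDens n s v z‖ₑ ∂Measure.pi (fun _ : Fin n => gaussianReal 0 1)
      = ∫⁻ x, ‖gsn n s x‖ₑ := by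
  set q : (Fin n → ℝ) → ℝ := fun x => ∏ j, gaussianPDFReal 0 (v j) (x j) with hq
  have hqm : Measurable q := measurable_prod_gaussianPDFReal_right v
  have hm : Measurable fun x => ‖(q x)⁻¹ • gsn n s x‖ₑ :=
    (hqm.inv.stronglyMeasurable.smul (stronglyMeasurable_gsn_right n s)).enorm
  have h1 : ∫⁻ z, ‖normDens n s v z‖ₑ ∂Measure.pi (fun _ : Fin n => gaussianReal 0 1)
      = ∫⁻ x, ‖(q x)⁻¹ • gsn n s x‖ₑ ∂(volume.withDensity fun x => ENNReal.ofReal (q x)) := by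
    rw [← (measurePreserving_rescale hv).map_eq, lintegral_map hm (measurable_rescale v)]
    rfl
  rw [h1, lintegral_withDensity_eq_lintegral_mul _ hqm.ennreal_ofReal hm]
  refine lintegral_congr fun x => ?_
  have h := prod_gaussianPDFReal_pos hv x
  rw [Pi.mul_apply, ← Real.enorm_of_nonneg h.le, ← enorm_smul, smul_smul, mul_inv_cancel₀ h.ne',
    one_smul]

lemma integral_normDens_snoc {s : Fin (n + 1) → ℝ} {v : Fin (n + 1) → NNReal} {C : ℝ}
    (hs : ∀ j, 0 < s j) (hv : ∀ j, v j ≠ 0)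
    (hC : ∀ x, ‖gsn (n + 1) s x‖ ≤ C * ∏ j, gaussianPDFReal 0 (v j) (x j)) (z : Fin n → ℝ) :
    ∫ t, normDens (n + 1) s v (Fin.snoc z t) ∂gaussianReal 0 1
      = normDens n (Fin.init s) (Fin.init v) z := by
  set y : Fin n → ℝ := rescale (Fin.init v) z with hy
  set q : ℝ := ∏ j, gaussianPDFReal 0 (Fin.init v j) (y j) with hq
  have hr : ∀ t, rescale v (Fin.snoc z t) = Fin.snoc y (√(v (Fin.last n) : ℝ) * t) := by
    intro t
    ext j
    refine Fin.lastCases ?_ (fun i => ?_) j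
    · simp [rescale]
    · simp [rescale, y, Fin.init]
  have hp : ∀ t : ℝ, ∏ j, gaussianPDFReal 0 (v j) ((Fin.snoc y t : Fin (n + 1) → ℝ) j)
      = q * gaussianPDFReal 0 (v (Fin.last n)) t := by
    intro t
    rw [Fin.prod_univ_castSucc]
    simp [q, Fin.init]
  have hsm : Continuous fun t : ℝ => (Fin.snoc y t : Fin (n + 1) → ℝ) := continuous_snoc_left y
  have hgm : StronglyMeasurable fun t : ℝ => gsn (n + 1) s (Fin.snoc y t) :=
    (stronglyMeasurable_gsn_right _ s).comp_measurable hsm.measurable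
  have hint : Integrable fun t : ℝ => gsn (n + 1) s (Fin.snoc y t) := by
    refine ((integrable_gaussianPDFReal 0 (v (Fin.last n))).const_mul (C * q)).mono'
      hgm.aestronglyMeasurable (ae_of_all _ fun t => (hC _).trans_eq ?_)
    rw [hp, mul_assoc]
  have hm : StronglyMeasurable fun t : ℝ =>
      (q * gaussianPDFReal 0 (v (Fin.last n)) t)⁻¹ • gsn (n + 1) s (Fin.snoc y t) :=
    ((measurable_gaussianPDFReal _ _).const_mul q).inv.stronglyMeasurable.smul hgm
  have h1 : ∫ t, normDens (n + 1) s v (Fin.snoc z t) ∂gaussianReal 0 1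
      = ∫ t, (q * gaussianPDFReal 0 (v (Fin.last n)) t)⁻¹ • gsn (n + 1) s (Fin.snoc y t)
        ∂gaussianReal 0 (v (Fin.last n)) := by
    rw [← (measurePreserving_sqrt_mul (v (Fin.last n))).map_eq, integral_map
      (measurePreserving_sqrt_mul _).measurable.aemeasurable
      hm.aestronglyMeasurable]
    refine integral_congr_ae (ae_of_all _ fun t => ?_)
    simp only [normDens, hr, hp]
  rw [h1, integral_gaussianReal_eq_integral_smul (hv _)]
  have h2 : ∀ t, gaussianPDFReal 0 (v (Fin.last n)) t •
      (q * gaussianPDFReal 0 (v (Fin.last n)) t)⁻¹ • gsn (n + 1) s (Fin.snoc y t)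
      = q⁻¹ • gsn (n + 1) s (Fin.snoc y t) := by
    intro t
    have h := gaussianPDFReal_pos 0 (v (Fin.last n)) t (hv _)
    rw [smul_smul]
    congr 1
    rw [mul_inv, mul_left_comm, mul_inv_cancel₀ h.ne', mul_one]
  simp only [h2]
  rw [integral_smul, integral_gsn_snoc hs y hint]
  rfl

end GaussianTransport

section ExponentialLaw

open ProbabilityTheory Filter Topology

/-- The density of the exponential law with mean `b`. -/
noncomputable def expDens (b : ℝ) : ℝ → ℝ :=
  (Ioi (0 : ℝ)).indicator fun x => b⁻¹ * Real.exp (-x / b)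

/-- The exponential law with mean `b`. -/
noncomputable def expLaw (b : ℝ) : Measure ℝ :=
  volume.withDensity fun x => ENNReal.ofReal (expDens b x)

lemma measurable_expDens (b : ℝ) : Measurable (expDens b) :=
  Measurable.indicator (by fun_prop) measurableSet_Ioi

lemma expDens_nonneg {b : ℝ} (hb : 0 < b) (x : ℝ) : 0 ≤ expDens b x :=
  indicator_nonneg (fun _ _ => by positivity) x

lemma lintegral_rpow_expLaw {b q : ℝ} (hb : 0 < b) (hq : -1 < q) :
    ∫⁻ x, ENNReal.ofReal (x ^ q) ∂expLaw b = ENNReal.ofReal (b ^ q * Real.Gamma (q + 1)) := by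
  have hI := Real.integral_rpow_mul_exp_neg_mul_Ioi (a := q + 1) (r := b⁻¹) (by linarith)
    (by positivity)
  have hG : 0 < Real.Gamma (q + 1) := Real.Gamma_pos_of_pos (by linarith)
  have hint : IntegrableOn (fun t : ℝ => t ^ (q + 1 - 1) * Real.exp (-(b⁻¹ * t))) (Ioi 0) := by
    by_contra h
    have h' := integral_undef h
    rw [hI] at h'
    have : 0 < (1 / b⁻¹) ^ (q + 1) * Real.Gamma (q + 1) := by positivity
    linarith
  have hval : b ^ q * Real.Gamma (q + 1)
      = b⁻¹ * ∫ t in Ioi (0 : ℝ), t ^ (q + 1 - 1) * Real.exp (-(b⁻¹ * t)) := by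
    rw [hI, one_div, inv_inv, Real.rpow_add hb, Real.rpow_one]
    field_simp
  rw [hval, ← integral_const_mul, ofReal_integral_eq_lintegral_ofReal (hint.const_mul b⁻¹)]
  · rw [expLaw, lintegral_withDensity_eq_lintegral_mul _ (measurable_expDens b).ennreal_ofReal
      (by fun_prop), ← lintegral_indicator measurableSet_Ioi]
    refine lintegral_congr fun x => ?_
    by_cases hx : x ∈ Ioi (0 : ℝ)
    · rw [indicator_of_mem hx, Pi.mul_apply, expDens, indicator_of_mem hx,
        ← ENNReal.ofReal_mul (by positivity), add_sub_cancel_right, neg_div, div_eq_inv_mul]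
      congr 1; ring
    · rw [indicator_of_notMem hx, Pi.mul_apply, expDens, indicator_of_notMem hx]
      simp
  · filter_upwards [ae_restrict_mem measurableSet_Ioi] with x hx
    have : 0 < x := hx
    simp only [Pi.zero_apply]
    positivity

lemma isProbabilityMeasure_expLaw {b : ℝ} (hb : 0 < b) : IsProbabilityMeasure (expLaw b) := by
  refine ⟨?_⟩
  have := lintegral_rpow_expLaw hb (q := 0) (by norm_num)
  simpa using this

lemma ae_pos_expLaw (b : ℝ) : ∀ᵐ x ∂expLaw b, 0 < x := by
  rw [expLaw, ae_withDensity_iff (measurable_expDens b).ennreal_ofReal]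
  refine ae_of_all _ fun x hx => ?_
  by_contra h
  exact hx (by simp [expDens, h])

lemma ae_summable_of_lintegral_le {α : Type*} [MeasurableSpace α] {μ : Measure α}
    {f : ℕ → α → ℝ} (hf : ∀ l, Measurable (f l)) (h0 : ∀ l, ∀ᵐ x ∂μ, 0 ≤ f l x) {c : ℕ → ℝ}
    (hc : Summable c) (h : ∀ l, ∫⁻ x, ENNReal.ofReal (f l x) ∂μ ≤ ENNReal.ofReal (c l)) :
    ∀ᵐ x ∂μ, Summable fun l => f l x := by
  have h1 : ∫⁻ x, ∑' l, ENNReal.ofReal (f l x) ∂μ ≠ ⊤ := by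
    rw [lintegral_tsum fun l => (hf l).ennreal_ofReal.aemeasurable]
    exact ne_top_of_le_ne_top hc.tsum_ofReal_ne_top (ENNReal.tsum_le_tsum h)
  filter_upwards [ae_lt_top (Measurable.tsum fun l => (hf l).ennreal_ofReal) h1,
    ae_all_iff.2 h0] with x hx hx0
  refine (ENNReal.summable_toReal hx.ne).congr fun l => ?_
  exact ENNReal.toReal_ofReal (hx0 l)

lemma summable_of_summable_rpow {y : ℕ → ℝ} (hy : ∀ l, 0 ≤ y l) {p : ℝ} (hp0 : 0 < p)
    (hp1 : p ≤ 1) (h : Summable fun l => y l ^ p) : Summable y := by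
  refine summable_of_isBigO_nat h (Asymptotics.IsBigO.of_bound 1 ?_)
  have ht := h.tendsto_atTop_zero.eventually (gt_mem_nhds one_pos)
  filter_upwards [ht] with l hl
  have h1 : y l ≤ 1 := by
    by_contra hc
    push Not at hc
    exact absurd (Real.one_lt_rpow hc hp0) (not_lt.2 hl.le)
  rw [one_mul, Real.norm_of_nonneg (hy l), Real.norm_of_nonneg (Real.rpow_nonneg (hy l) p)]
  exact Real.self_le_rpow_of_le_one (hy l) h1 hp1

lemma sqrt_one_add_le {y : ℝ} (hy : 0 ≤ y) : √(1 + y) ≤ 1 + y ^ (2 / 3 : ℝ) := by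
  set t := y ^ (2 / 3 : ℝ) with ht
  have ht0 : 0 ≤ t := Real.rpow_nonneg hy _
  refine Real.sqrt_le_iff.2 ⟨by linarith, ?_⟩
  have h : y ≤ t + t ^ 2 := by
    rcases le_total y 1 with h1 | h1
    · have := Real.self_le_rpow_of_le_one hy h1 (by norm_num : (2 / 3 : ℝ) ≤ 1)
      nlinarith [sq_nonneg t]
    · have h2 : t ^ 2 = y ^ (4 / 3 : ℝ) := by
        rw [ht, ← Real.rpow_natCast, ← Real.rpow_mul hy]; norm_num
      have := Real.self_le_rpow_of_one_le h1 (by norm_num : (1 : ℝ) ≤ 4 / 3)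
      rw [h2]; linarith
  nlinarith

lemma summable_add_one_rpow {r : ℝ} (hr : r < -1) : Summable fun l : ℕ => ((l : ℝ) + 1) ^ r := by
  have := (summable_nat_add_iff 1).2 (Real.summable_nat_rpow.2 hr)
  simpa using this

lemma ae_forall_pos {β : ℕ → ℝ} {P : Measure (ℕ → ℝ)}
    (hP : ∀ i, MeasurePreserving (fun s : ℕ → ℝ => s i) P (expLaw (β i))) :
    ∀ᵐ s ∂P, ∀ i : ℕ, 0 < s i :=
  ae_all_iff.2 fun i => (hP i).quasiMeasurePreserving.ae (ae_pos_expLaw (β i))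

lemma lintegral_mul_rpow_coord {β : ℕ → ℝ} {δ : ℝ} (hβ : ∀ i : ℕ, β i = ((i : ℝ) + 1) ^ δ)
    {P : Measure (ℕ → ℝ)} (hP : ∀ i, MeasurePreserving (fun s : ℕ → ℝ => s i) P (expLaw (β i)))
    {q r : ℝ} (hq : -1 < q) (l : ℕ) :
    ∫⁻ s, ENNReal.ofReal (((l : ℝ) + 1) ^ r * s l ^ q) ∂P
      = ENNReal.ofReal (((l : ℝ) + 1) ^ (r + δ * q) * Real.Gamma (q + 1)) := by
  have hl : (0 : ℝ) < (l : ℝ) + 1 := by positivity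
  have hb : 0 < β l := by rw [hβ]; positivity
  have hm : Measurable fun x : ℝ => ENNReal.ofReal (((l : ℝ) + 1) ^ r * x ^ q) := by fun_prop
  have h1 := (hP l).lintegral_comp hm
  rw [h1]
  simp only [ENNReal.ofReal_mul (Real.rpow_nonneg hl.le r)]
  rw [lintegral_const_mul _ (by fun_prop), lintegral_rpow_expLaw hb hq,
    ← ENNReal.ofReal_mul (by positivity), ← mul_assoc, hβ, ← Real.rpow_mul hl.le,
    ← Real.rpow_add hl]

lemma ae_summable_rpow_mul {β : ℕ → ℝ} {δ : ℝ} (hβ : ∀ i : ℕ, β i = ((i : ℝ) + 1) ^ δ)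
    {P : Measure (ℕ → ℝ)} (hP : ∀ i, MeasurePreserving (fun s : ℕ → ℝ => s i) P (expLaw (β i)))
    {r : ℝ} (hr : r + δ < -1) :
    ∀ᵐ s ∂P, Summable fun l : ℕ => ((l : ℝ) + 1) ^ r * s l := by
  refine ae_summable_of_lintegral_le (c := fun l => ((l : ℝ) + 1) ^ (r + δ)) (fun l => by fun_prop)
    (fun l => ?_) (summable_add_one_rpow hr) fun l => ?_
  · filter_upwards [ae_forall_pos hP] with s hs
    have := hs l
    positivity
  · have := lintegral_mul_rpow_coord hβ hP (q := 1) (r := r) (by norm_num) l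
    simp only [Real.rpow_one, mul_one] at this
    rw [this]
    norm_num [Real.Gamma_two]

lemma ae_summable_rpow_div {β : ℕ → ℝ} {δ : ℝ} (hβ : ∀ i : ℕ, β i = ((i : ℝ) + 1) ^ δ)
    {P : Measure (ℕ → ℝ)} (hP : ∀ i, MeasurePreserving (fun s : ℕ → ℝ => s i) P (expLaw (β i)))
    {a : ℝ} (ha : a - δ < -1) :
    ∀ᵐ s ∂P, Summable fun l : ℕ => ((l : ℝ) + 1) ^ a / s l := by
  obtain ⟨p, hp0, hp1, hp2⟩ : ∃ p : ℝ, 0 < p ∧ p < 1 ∧ (a - δ) * p < -1 := by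
    refine ⟨2 / (δ - a + 1), by apply div_pos <;> linarith, ?_, ?_⟩
    · rw [div_lt_one (by linarith)]; linarith
    · rw [← mul_div_assoc, div_lt_iff₀ (by linarith)]; linarith
  have h := ae_summable_of_lintegral_le (μ := P)
    (f := fun l s => ((l : ℝ) + 1) ^ (a * p) * s l ^ (-p))
    (c := fun l => ((l : ℝ) + 1) ^ (a * p + δ * (-p)) * Real.Gamma (-p + 1)) (fun l => by fun_prop)
    (fun l => ?_) ((summable_add_one_rpow (by linarith)).mul_right _)
    (fun l => (lintegral_mul_rpow_coord hβ hP (by linarith) l).le)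
  · filter_upwards [ae_forall_pos hP, h] with s hs hsum
    refine summable_of_summable_rpow (fun l => (div_pos (by positivity) (hs l)).le) hp0 hp1.le ?_
    refine hsum.congr fun l => ?_
    rw [Real.div_rpow (by positivity) (hs l).le, ← Real.rpow_mul (by positivity),
      Real.rpow_neg (hs l).le, div_eq_mul_inv]
  · filter_upwards [ae_forall_pos hP] with s hs
    have := hs l
    positivity

lemma exists_lintegral_prod_sqrt_le {β : ℕ → ℝ} {δ : ℝ} (hβ : ∀ i : ℕ, β i = ((i : ℝ) + 1) ^ δ)
    {P : Measure (ℕ → ℝ)} (hP : ∀ i, MeasurePreserving (fun s : ℕ → ℝ => s i) P (expLaw (β i)))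
    (hδ : 5 / 2 < δ)
    (hind : iIndepFun (fun (i : ℕ) (s : ℕ → ℝ) => s i) P) :
    ∃ R : ℝ, ∀ n : ℕ, ∫⁻ s, ∏ j : Fin n, ENNReal.ofReal (√(1 + ((j : ℕ) + 1) / s j)) ∂P
      ≤ ENNReal.ofReal R := by
  set c : ℕ → ℝ := fun l =>
    ((l : ℝ) + 1) ^ ((2 / 3 : ℝ) + δ * (-(2 / 3))) * Real.Gamma (-(2 / 3) + 1)
    with hc
  have hΓ : 0 < Real.Gamma (-(2 / 3) + 1) := Real.Gamma_pos_of_pos (by norm_num)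
  have hc0 : ∀ l, 0 ≤ c l := fun l => by positivity
  have hcs : Summable c := (summable_add_one_rpow (by linarith)).mul_right _
  refine ⟨Real.exp (∑' l, c l), fun n => ?_⟩
  have hprob : IsProbabilityMeasure P := hind.isProbabilityMeasure
  have hone : ∀ l : ℕ, ∫⁻ s, ENNReal.ofReal (√(1 + ((l : ℝ) + 1) / s l)) ∂P
      ≤ ENNReal.ofReal (Real.exp (c l)) := by
    intro l
    calc _ ≤ ∫⁻ s, (1 + ENNReal.ofReal
            (((l : ℝ) + 1) ^ (2 / 3 : ℝ) * s l ^ (-(2 / 3) : ℝ))) ∂P := by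
          refine lintegral_mono_ae ?_
          filter_upwards [ae_forall_pos hP] with s hs
          have hsl := hs l
          rw [← ENNReal.ofReal_one, ← ENNReal.ofReal_add zero_le_one (by positivity)]
          refine ENNReal.ofReal_le_ofReal ((sqrt_one_add_le (by positivity)).trans_eq ?_)
          rw [Real.div_rpow (by positivity) hsl.le, Real.rpow_neg hsl.le, div_eq_mul_inv]
      _ = 1 + ENNReal.ofReal (c l) := by
          rw [lintegral_add_left measurable_const, lintegral_mul_rpow_coord hβ hP (by norm_num)]
          simp [hc]
      _ ≤ _ := by
          rw [← ENNReal.ofReal_one, ← ENNReal.ofReal_add zero_le_one (hc0 l)]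
          refine ENNReal.ofReal_le_ofReal ?_
          rw [add_comm]
          exact Real.add_one_le_exp _
  have hX : iIndepFun (fun (j : Fin n) (s : ℕ → ℝ) =>
      ENNReal.ofReal (√(1 + (((j : ℕ) : ℝ) + 1) / s j))) P :=
    (hind.precomp Fin.val_injective).comp
      (fun j x => ENNReal.ofReal (√(1 + (((j : ℕ) : ℝ) + 1) / x))) fun j => by fun_prop
  have h2 := lintegral_prod_eq_prod_lintegral_of_indepFun Finset.univ _ hX
    (fun j => by fun_prop)
  rw [h2]
  calc _ ≤ ∏ j : Fin n, ENNReal.ofReal (Real.exp (c j)) :=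
        Finset.prod_le_prod' fun j _ => hone j
    _ = ENNReal.ofReal (Real.exp (∑ j : Fin n, c j)) := by
        rw [Real.exp_sum, ENNReal.ofReal_prod_of_nonneg fun _ _ => (Real.exp_pos _).le]
    _ ≤ _ := by
        refine ENNReal.ofReal_le_ofReal (Real.exp_le_exp.2 ?_)
        rw [← Finset.sum_range c]
        exact hcs.sum_le_tsum _ fun l _ => hc0 l

end ExponentialLaw

section Construction

open ProbabilityTheory Filter Topology

/-- The sum `∑ (l+1)^a / s_l`, with the value `0` if it diverges. -/
noncomputable def weightSum (a : ℝ) (s : ℕ → ℝ) : ℝ :=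
  (∑' l : ℕ, ENNReal.ofReal (((l : ℝ) + 1) ^ a / s l)).toReal

/-- The variances of the Gaussian product measure dominating `gsn`. -/
noncomputable def domVar (W a : ℝ) (s : ℕ → ℝ) (j : ℕ) : NNReal :=
  Real.toNNReal (s j + W * weightSum a s * ((j : ℝ) + 1) ^ a)

lemma measurable_domVar (W a : ℝ) : Measurable (domVar W a) := by
  have h : Measurable (weightSum a) :=
    (Measurable.tsum fun l => by fun_prop).ennreal_toReal
  refine measurable_pi_lambda _ fun j => ?_
  unfold domVar
  fun_prop

/-- The sequence of Gaussian-normalized densities. -/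
noncomputable def densSeq (W a : ℝ) (n : ℕ) (s z : ℕ → ℝ) : ℂ :=
  normDens n (firstCoords n s) (fun j => domVar W a s j) (firstCoords n z)

lemma stronglyMeasurable_densSeq (W a : ℝ) (n : ℕ) :
    StronglyMeasurable fun p : (ℕ → ℝ) × (ℕ → ℝ) => densSeq W a n p.1 p.2 := by
  have h1 : Measurable fun p : (ℕ → ℝ) × (ℕ → ℝ) => (fun j : Fin n => domVar W a p.1 j) :=
    measurable_pi_lambda _ fun j =>
      (measurable_pi_apply (j : ℕ)).comp ((measurable_domVar W a).comp measurable_fst)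
  have h := (stronglyMeasurable_normDens n).comp_measurable
    (((measurable_firstCoords n).comp measurable_fst).prodMk
      (h1.prodMk ((measurable_firstCoords n).comp measurable_snd)))
  simp only [Function.comp_def] at h
  exact h

lemma weightSum_eq {a : ℝ} {s : ℕ → ℝ} (hs : ∀ l, 0 < s l)
    (hsum : Summable fun l : ℕ => ((l : ℝ) + 1) ^ a / s l) :
    weightSum a s = ∑' l : ℕ, ((l : ℝ) + 1) ^ a / s l := by
  have h0 : ∀ l : ℕ, 0 ≤ ((l : ℝ) + 1) ^ a / s l := fun l => (div_pos (by positivity) (hs l)).le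
  rw [weightSum, ← ENNReal.ofReal_tsum_of_nonneg h0 hsum, ENNReal.toReal_ofReal (tsum_nonneg h0)]

section FixedScale

variable {ε : ℝ} {s : ℕ → ℝ}

lemma coe_domVar {W a : ℝ} (hW : 0 ≤ W) (hs : ∀ l, 0 < s l) (j : ℕ) :
    (domVar W a s j : ℝ) = s j + W * weightSum a s * ((j : ℝ) + 1) ^ a :=
  Real.coe_toNNReal _ (add_nonneg (hs j).le
    (mul_nonneg (mul_nonneg hW ENNReal.toReal_nonneg) (by positivity)))

lemma domVar_ne_zero {W a : ℝ} (hW : 0 ≤ W) (hs : ∀ l, 0 < s l) (j : ℕ) : domVar W a s j ≠ 0 := by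
  rw [← NNReal.coe_ne_zero, coe_domVar hW hs]
  exact (add_pos_of_pos_of_nonneg (hs j)
    (mul_nonneg (mul_nonneg hW ENNReal.toReal_nonneg) (by positivity))).ne'

lemma norm_gsn_firstCoords_le (hε : 0 < ε) (hs : ∀ l, 0 < s l)
    (hsum : Summable fun l : ℕ => ((l : ℝ) + 1) ^ (3 / 2 + ε) / s l) {W : ℝ}
    (hW : W = ∑' l : ℕ, ((l : ℝ) + 1) ^ (-(1 + ε))) (n : ℕ) (x : Fin n → ℝ) :
    ‖gsn n (firstCoords n s) x‖
      ≤ Real.exp (W * weightSum (3 / 2 + ε) s * weightSum (3 / 2 + ε) s / 2)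
        * ∏ j : Fin n, gaussianPDFReal 0 (domVar W (3 / 2 + ε) s j) (x j) := by
  have hW0 : 0 ≤ W := hW ▸ tsum_nonneg fun l => by positivity
  refine norm_gsn_le_prod_gaussianPDFReal (fun i => hs i) hε.le ?_ ?_
    (fun j => coe_domVar hW0 hs j) x
  · rw [hW, ← Finset.sum_range fun l : ℕ => ((l : ℝ) + 1) ^ (-(1 + ε))]
    exact (summable_add_one_rpow (by linarith)).sum_le_tsum _ fun l _ => by positivity
  · rw [weightSum_eq hs hsum]
    change ∑ j : Fin n, (((j : ℕ) : ℝ) + 1) ^ (3 / 2 + ε) / s (j : ℕ) ≤ _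
    rw [← Finset.sum_range fun l : ℕ => ((l : ℝ) + 1) ^ (3 / 2 + ε) / s l]
    exact hsum.sum_le_tsum _ fun l _ => (div_pos (by positivity) (hs l)).le

lemma stronglyMeasurable_normDens_right (n : ℕ) (s : Fin n → ℝ) (v : Fin n → NNReal) :
    StronglyMeasurable (normDens n s v) := by
  have h : Measurable fun z : Fin n → ℝ => (s, v, z) := by fun_prop
  have h' := (stronglyMeasurable_normDens n).comp_measurable h
  simp only [Function.comp_def] at h'
  exact h'

lemma domVar_facts (hε : 0 < ε) (hs : ∀ l, 0 < s l)
    (hsum : Summable fun l : ℕ => ((l : ℝ) + 1) ^ (3 / 2 + ε) / s l) {W : ℝ}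
    (hW : W = ∑' l : ℕ, ((l : ℝ) + 1) ^ (-(1 + ε))) :
    ∃ C : ℝ, (∀ n z, ‖normDens n (firstCoords n s)
        (fun j => domVar W (3 / 2 + ε) s j) z‖ ≤ C) ∧
      ∀ n z, ∫ t, normDens (n + 1) (firstCoords (n + 1) s)
          (fun j => domVar W (3 / 2 + ε) s j) (Fin.snoc z t) ∂gaussianReal 0 1
        = normDens n (firstCoords n s) (fun j => domVar W (3 / 2 + ε) s j) z := by
  have hW0 : 0 ≤ W := hW ▸ tsum_nonneg fun l => by positivity
  exact ⟨_, fun n z => norm_normDens_le (fun j => domVar_ne_zero hW0 hs _)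
    (norm_gsn_firstCoords_le hε hs hsum hW n) z,
    fun n z => integral_normDens_snoc (fun j => hs _) (fun j => domVar_ne_zero hW0 hs _)
    (norm_gsn_firstCoords_le hε hs hsum hW (n + 1)) z⟩

lemma ae_exists_tendsto_densSeq (hε : 0 < ε) (hs : ∀ l, 0 < s l)
    (hsum : Summable fun l : ℕ => ((l : ℝ) + 1) ^ (3 / 2 + ε) / s l) {W : ℝ}
    (hW : W = ∑' l : ℕ, ((l : ℝ) + 1) ^ (-(1 + ε))) :
    ∀ᵐ z ∂Measure.infinitePi (fun _ : ℕ => gaussianReal 0 1),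
      ∃ l, Tendsto (fun n => densSeq W (3 / 2 + ε) n s z) atTop (𝓝 l) := by
  obtain ⟨C, hC, hstep⟩ := domVar_facts hε hs hsum hW
  exact ae_exists_tendsto_firstCoords (fun n => stronglyMeasurable_normDens_right n _ _) hC hstep

lemma setIntegral_lim_densSeq (hε : 0 < ε) (hs : ∀ l, 0 < s l)
    (hsum : Summable fun l : ℕ => ((l : ℝ) + 1) ^ (3 / 2 + ε) / s l) {W : ℝ}
    (hW : W = ∑' l : ℕ, ((l : ℝ) + 1) ^ (-(1 + ε))) {f : (ℕ → ℝ) → ℂ}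
    (hf : ∀ᵐ z ∂Measure.infinitePi (fun _ : ℕ => gaussianReal 0 1),
      Tendsto (fun n => densSeq W (3 / 2 + ε) n s z) atTop (𝓝 (f z)))
    (n : ℕ) {E : Set (Fin n → ℝ)} (hE : MeasurableSet E) :
    ∫ z in {z | firstCoords n (rescale (domVar W (3 / 2 + ε) s) z) ∈ E}, f z
        ∂Measure.infinitePi (fun _ : ℕ => gaussianReal 0 1)
      = ∫ x in E, gsn n (firstCoords n s) x := by
  have hW0 : 0 ≤ W := hW ▸ tsum_nonneg fun l => by positivity
  obtain ⟨C, hC, hstep⟩ := domVar_facts hε hs hsum hW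
  have hmeas := fun n => stronglyMeasurable_normDens_right n (firstCoords n s)
    (fun j => domVar W (3 / 2 + ε) s j)
  have hconst : ∀ m, n ≤ m →
      ∫ z in {z | firstCoords n (rescale (domVar W (3 / 2 + ε) s) z) ∈ E},
        densSeq W (3 / 2 + ε) m s z ∂Measure.infinitePi (fun _ : ℕ => gaussianReal 0 1)
      = ∫ x in E, gsn n (firstCoords n s) x := by
    intro m hm
    rw [← setIntegral_normDens (v := fun j : Fin n => domVar W (3 / 2 + ε) s j)
      (fun j => domVar_ne_zero hW0 hs _) hE]
    exact setIntegral_firstCoords_of_le hmeas hC hstep hm (measurable_rescale _ hE)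
  have hlim : Tendsto (fun m => ∫ z in {z | firstCoords n (rescale (domVar W (3 / 2 + ε) s) z) ∈ E},
        densSeq W (3 / 2 + ε) m s z ∂Measure.infinitePi (fun _ : ℕ => gaussianReal 0 1)) atTop
      (𝓝 (∫ z in {z | firstCoords n (rescale (domVar W (3 / 2 + ε) s) z) ∈ E}, f z
        ∂Measure.infinitePi (fun _ : ℕ => gaussianReal 0 1))) := by
    refine tendsto_integral_of_dominated_convergence (fun _ => C) (fun m => ?_)
      (integrable_const C) (fun m => ae_of_all _ fun z => hC m _) (ae_restrict_of_ae hf)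
    exact ((hmeas m).comp_measurable (measurable_firstCoords m)).aestronglyMeasurable
  refine tendsto_nhds_unique hlim (tendsto_const_nhds.congr' ?_)
  filter_upwards [eventually_ge_atTop n] with m hm using (hconst m hm).symm

lemma lintegral_norm_densSeq_le {W a : ℝ} (hW : 0 ≤ W) (hs : ∀ l, 0 < s l) (n : ℕ) :
    ∫⁻ z, ‖densSeq W a n s z‖ₑ ∂Measure.infinitePi (fun _ : ℕ => gaussianReal 0 1)
      ≤ ∏ j : Fin n, ENNReal.ofReal (√(1 + ((j : ℕ) + 1) / s j)) := by
  refine le_trans (le_of_eq ?_) (lintegral_norm_gsn_le (s := firstCoords n s) fun i => hs i)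
  rw [← lintegral_norm_normDens (v := fun j : Fin n => domVar W a s j)
    (fun j => domVar_ne_zero hW hs _),
    ← (measurePreserving_firstCoords (fun _ => gaussianReal 0 1) n).lintegral_comp
      (stronglyMeasurable_normDens_right n _ _).enorm]
  rfl

lemma lintegral_sq_gaussianReal : ∫⁻ x, ENNReal.ofReal (x ^ 2) ∂gaussianReal 0 1 = 1 := by
  have hm : MemLp (id : ℝ → ℝ) 2 (gaussianReal 0 1) := memLp_id_gaussianReal 2
  have h1 := variance_of_integral_eq_zero (X := (id : ℝ → ℝ)) (μ := gaussianReal 0 1)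
    measurable_id.aemeasurable (by simp)
  rw [variance_id_gaussianReal] at h1
  have h2 : Integrable (fun x : ℝ => x ^ 2) (gaussianReal 0 1) := hm.integrable_sq
  rw [← ofReal_integral_eq_lintegral_ofReal h2 (ae_of_all _ fun x => sq_nonneg x)]
  simp only [id] at h1
  rw [← h1]
  simp

lemma ae_summable_rescale {γ W a : ℝ} (hW : 0 ≤ W) (hs : ∀ l, 0 < s l) (ha : a - γ < -1)
    (hsγ : Summable fun l : ℕ => ((l : ℝ) + 1) ^ (-γ) * s l) :
    ∀ᵐ z ∂Measure.infinitePi (fun _ : ℕ => gaussianReal 0 1),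
      Summable fun l : ℕ => ((l : ℝ) + 1) ^ (-γ) * rescale (domVar W a s) z l ^ 2 := by
  refine ae_summable_of_lintegral_le (c := fun l => ((l : ℝ) + 1) ^ (-γ) * (domVar W a s l : ℝ))
    (fun l => ?_) (fun l => ae_of_all _ fun z => by positivity) ?_ fun l => ?_
  · exact (((measurable_pi_apply l).comp (measurable_rescale _)).pow_const 2).const_mul _
  · have h : ∀ l : ℕ, ((l : ℝ) + 1) ^ (-γ) * (domVar W a s l : ℝ)
        = ((l : ℝ) + 1) ^ (-γ) * s l + W * weightSum a s * ((l : ℝ) + 1) ^ (a - γ) := by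
      intro l
      rw [coe_domVar hW hs, sub_eq_add_neg a, Real.rpow_add (by positivity)]
      ring
    simp only [h]
    exact hsγ.add ((summable_add_one_rpow ha).mul_left _)
  · have h : ∀ z : ℕ → ℝ, ENNReal.ofReal (((l : ℝ) + 1) ^ (-γ) * rescale (domVar W a s) z l ^ 2)
        = ENNReal.ofReal (((l : ℝ) + 1) ^ (-γ) * (domVar W a s l : ℝ))
          * ENNReal.ofReal (z l ^ 2) := by
      intro z
      rw [← ENNReal.ofReal_mul (by positivity), rescale, mul_pow, Real.sq_sqrt NNReal.zero_le_coe,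
        mul_assoc]
    simp only [h]
    rw [lintegral_const_mul _ (by fun_prop),
      (measurePreserving_eval_infinitePi (fun _ : ℕ => gaussianReal 0 1) l).lintegral_comp
        (f := fun x => ENNReal.ofReal (x ^ 2)) (by fun_prop), lintegral_sq_gaussianReal, mul_one]

end FixedScale

end Construction

section Existence

open ProbabilityTheory Filter Topology

lemma prod_expDens {β : ℕ → ℝ} {n : ℕ} (s : Fin n → ℝ) :
    ∏ i : Fin n, expDens (β i) (s i)
      = (Set.univ.pi fun _ : Fin n => Ioi (0 : ℝ)).indicator
        (fun s => ∏ i : Fin n, (β (i : ℕ))⁻¹ * Real.exp (-(s i) / β (i : ℕ))) s := by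
  by_cases h : s ∈ Set.univ.pi fun _ : Fin n => Ioi (0 : ℝ)
  · rw [indicator_of_mem h]
    exact Finset.prod_congr rfl fun i _ => indicator_of_mem (h i (Set.mem_univ i)) _
  · rw [indicator_of_notMem h]
    simp only [Set.mem_pi, Set.mem_univ, true_implies, not_forall] at h
    obtain ⟨i, hi⟩ := h
    exact Finset.prod_eq_zero (Finset.mem_univ i) (indicator_of_notMem hi _)

lemma integrable_expDens {b : ℝ} (hb : 0 < b) : Integrable (expDens b) := by
  refine ⟨(measurable_expDens b).aestronglyMeasurable, ?_⟩
  have h := (isProbabilityMeasure_expLaw hb).measure_univ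
  rw [expLaw, withDensity_apply _ MeasurableSet.univ, Measure.restrict_univ] at h
  rw [hasFiniteIntegral_iff_ofReal (ae_of_all _ (expDens_nonneg hb)), h]
  exact ENNReal.one_lt_top

lemma rhoFT_eq_integral_pi {β : ℕ → ℝ} (hβ : ∀ i, 0 < β i) (n : ℕ) (x : Fin n → ℝ) :
    rhoFT β n x = ∫ s, gsn n s x ∂Measure.pi fun i : Fin n => expLaw (β i) := by
  have hpi := pi_withDensity_ofReal (p := fun i : Fin n => expDens (β i))
    (fun i => expDens_nonneg (hβ i)) (fun i => integrable_expDens (hβ i))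
  have hm : Measurable fun s : Fin n → ℝ => ENNReal.ofReal (∏ i : Fin n, expDens (β i) (s i)) :=
    (Finset.measurable_fun_prod Finset.univ fun (i : Fin n) _ =>
      (measurable_expDens (β i)).comp (measurable_pi_apply i)).ennreal_ofReal
  change _ = ∫ s, gsn n s x ∂Measure.pi fun i : Fin n =>
    volume.withDensity fun x => ENNReal.ofReal (expDens (β i) x)
  rw [hpi, integral_withDensity_eq_integral_toReal_smul hm
    (ae_of_all _ fun s => ENNReal.ofReal_lt_top), rhoFT,
    ← integral_indicator (MeasurableSet.univ_pi fun _ => measurableSet_Ioi)]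
  refine integral_congr_ae (ae_of_all _ fun s => ?_)
  simp only
  rw [ENNReal.toReal_ofReal (Finset.prod_nonneg fun (i : Fin n) _ => expDens_nonneg (hβ i) _),
    prod_expDens]
  by_cases h : s ∈ Set.univ.pi fun _ : Fin n => Ioi (0 : ℝ)
  · rw [indicator_of_mem h, indicator_of_mem h, Complex.real_smul]
  · rw [indicator_of_notMem h, indicator_of_notMem h, zero_smul]

lemma integral_setIntegral_gsn {β : ℕ → ℝ} (hβ : ∀ i, 0 < β i)
    [∀ i, IsProbabilityMeasure (expLaw (β i))] {n : ℕ} {R : ℝ}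
    (hR : ∫⁻ s, ∏ j : Fin n, ENNReal.ofReal (√(1 + ((j : ℕ) + 1) / s j))
      ∂Measure.infinitePi (fun i => expLaw (β i)) ≤ ENNReal.ofReal R) (E : Set (Fin n → ℝ)) :
    ∫ s, (∫ x in E, gsn n (firstCoords n s) x) ∂Measure.infinitePi (fun i => expLaw (β i))
      = ∫ x in E, rhoFT β n x := by
  have hmp := measurePreserving_firstCoords (fun i => expLaw (β i)) n
  have hsm : StronglyMeasurable fun p : (Fin n → ℝ) × (Fin n → ℝ) => gsn n p.1 p.2 :=
    stronglyMeasurable_gsn n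
  have hle : ∀ s : Fin n → ℝ, (∀ i, 0 < s i) → ∫⁻ x, ‖gsn n s x‖ₑ
      ≤ ∏ j : Fin n, ENNReal.ofReal (√(1 + ((j : ℕ) + 1) / s j)) :=
    fun s hs => lintegral_norm_gsn_le hs
  simp only [rhoFT_eq_integral_pi hβ]
  generalize gsn n = g at hsm hle ⊢
  have hsm' : StronglyMeasurable fun s : Fin n → ℝ => ∫ x in E, g s x :=
    hsm.integral_prod_right
  have hpos : ∀ᵐ s ∂Measure.pi (fun i : Fin n => expLaw (β i)), ∀ i, 0 < s i := by
    rw [ae_all_iff]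
    exact fun i => (measurePreserving_eval (fun i : Fin n => expLaw (β i))
      i).quasiMeasurePreserving.ae (ae_pos_expLaw (β i))
  have hmprod : Measurable fun s : Fin n → ℝ =>
      ∏ j : Fin n, ENNReal.ofReal (√(1 + ((j : ℕ) + 1) / s j)) :=
    Finset.measurable_fun_prod _ fun i _ => by fun_prop
  have hint : Integrable (Function.uncurry fun s x : Fin n → ℝ => g s x)
      ((Measure.pi fun i : Fin n => expLaw (β i)).prod (volume.restrict E)) := by
    refine ⟨hsm.aestronglyMeasurable, ?_⟩
    change ∫⁻ p : (Fin n → ℝ) × (Fin n → ℝ), ‖g p.1 p.2‖ₑ ∂_ < ⊤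
    rw [lintegral_prod _ hsm.enorm.aemeasurable]
    calc ∫⁻ s, (∫⁻ x in E, ‖g s x‖ₑ) ∂Measure.pi (fun i : Fin n => expLaw (β i))
        ≤ ∫⁻ s, ∏ j : Fin n, ENNReal.ofReal (√(1 + ((j : ℕ) + 1) / s j))
          ∂Measure.pi (fun i : Fin n => expLaw (β i)) := by
          refine lintegral_mono_ae ?_
          filter_upwards [hpos] with s hs
          exact (setLIntegral_le_lintegral _ _).trans (hle s hs)
      _ ≤ ENNReal.ofReal R := by
          rw [← hmp.lintegral_comp hmprod]
          exact hR
      _ < ⊤ := ENNReal.ofReal_lt_top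
  rw [← integral_integral_swap hint, ← hmp.map_eq,
    integral_map hmp.measurable.aemeasurable hsm'.aestronglyMeasurable]

/-- Fatou's lemma for the norms of an almost everywhere convergent sequence. -/
lemma integrable_of_tendsto_of_lintegral_le {α : Type*} [MeasurableSpace α] {μ : Measure α}
    {f : ℕ → α → ℂ} {g : α → ℂ} (hf : ∀ n, StronglyMeasurable (f n)) (hg : StronglyMeasurable g)
    (hlim : ∀ᵐ x ∂μ, Tendsto (fun n => f n x) atTop (𝓝 (g x))) {R : ℝ}
    (hR : ∀ n, ∫⁻ x, ‖f n x‖ₑ ∂μ ≤ ENNReal.ofReal R) : Integrable g μ := by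
  refine ⟨hg.aestronglyMeasurable, lt_of_le_of_lt ?_ (ENNReal.ofReal_lt_top (r := R))⟩
  calc ∫⁻ x, ‖g x‖ₑ ∂μ = ∫⁻ x, liminf (fun n => ‖f n x‖ₑ) atTop ∂μ := by
        refine lintegral_congr_ae ?_
        filter_upwards [hlim] with x hx
        exact hx.enorm.liminf_eq.symm
    _ ≤ liminf (fun n => ∫⁻ x, ‖f n x‖ₑ ∂μ) atTop := lintegral_liminf_le fun n => (hf n).enorm
    _ ≤ ENNReal.ofReal R := by
        refine (liminf_le_liminf (Eventually.of_forall hR)).trans ?_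
        simp

lemma setIntegral_prod_eq {α γ : Type*} [MeasurableSpace α] [MeasurableSpace γ] {P : Measure α}
    {G : Measure γ} [SFinite P] [SFinite G] {f : α × γ → ℂ} (hf : Integrable f (P.prod G))
    {A : Set (α × γ)} (hA : MeasurableSet A) :
    ∫ p in A, f p ∂P.prod G = ∫ s, (∫ z in {z | (s, z) ∈ A}, f (s, z) ∂G) ∂P := by
  rw [← integral_indicator hA, integral_prod _ (hf.indicator hA)]
  refine integral_congr_ae (ae_of_all _ fun s => ?_)
  exact integral_indicator (f := fun z => f (s, z)) (measurable_prodMk_left hA)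

end Existence

/-- Let `γ > 7/2`, `5/2 < δ < γ − 1` and `β_i = i^δ` (index `i : ℕ`
standing for `i+1 ≥ 1`). Then there is a complex measure `μ` of finite total variation on
the product space `ℝ^{ℕ}` whose pushforward under each coordinate projection onto `ℝⁿ` is
the Feynman–Thomas measure `μ^{(n)}` (with density `ρ_n`), and whose total variation
vanishes outside the set `{x : Σ_i i^{−γ} x_i² < ∞}`, i.e. `μ` is concentrated on the
Hilbert space `l²_{−γ}`. -/
theorem feynman_thomas_measure_exists (γ δ : ℝ) (hγ : 7 / 2 < γ)
    (hδ₁ : 5 / 2 < δ) (hδ₂ : δ < γ - 1)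
    (β : ℕ → ℝ) (hβ : ∀ i : ℕ, β i = ((i : ℝ) + 1) ^ δ) :
    ∃ μ : VectorMeasure (ℕ → ℝ) ℂ,
      (∀ n : ℕ, 1 ≤ n → ∀ E : Set (Fin n → ℝ), MeasurableSet E →
        μ ((fun (x : ℕ → ℝ) (i : Fin n) => x (i : ℕ)) ⁻¹' E) = ∫ x in E, rhoFT β n x) ∧
      (∀ E : Set (ℕ → ℝ), MeasurableSet E →
        (∀ x ∈ E, ¬ Summable (fun i : ℕ => ((i : ℝ) + 1) ^ (-γ) * x i ^ 2)) →
        μ E = 0) := by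
  set ε : ℝ := (δ - 5 / 2) / 2 with hε_def
  have hε : 0 < ε := by linarith
  have hβ0 : ∀ i, 0 < β i := fun i => by rw [hβ]; positivity
  have : ∀ i, IsProbabilityMeasure (expLaw (β i)) := fun i => isProbabilityMeasure_expLaw (hβ0 i)
  obtain ⟨W, hW⟩ : ∃ W : ℝ, W = ∑' l : ℕ, ((l : ℝ) + 1) ^ (-(1 + ε)) := ⟨_, rfl⟩
  have hW0 : 0 ≤ W := hW ▸ tsum_nonneg fun l => by positivity
  set P := Measure.infinitePi fun i => expLaw (β i)
  set G := Measure.infinitePi fun _ : ℕ => ProbabilityTheory.gaussianReal 0 1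
  have hP : ∀ i, MeasurePreserving (fun s : ℕ → ℝ => s i) P (expLaw (β i)) :=
    fun i => measurePreserving_eval_infinitePi (fun i => expLaw (β i)) i
  obtain ⟨R, hR⟩ := exists_lintegral_prod_sqrt_le hβ hP hδ₁
    (ProbabilityTheory.iIndepFun_infinitePi (X := fun _ x => x) fun _ => measurable_id)
  have hpos := ae_forall_pos hP
  have hsum := ae_summable_rpow_div hβ hP (a := 3 / 2 + ε) (by linarith)
  have hsγ := ae_summable_rpow_mul hβ hP (r := -γ) (by linarith)
  have hmeas := stronglyMeasurable_densSeq W (3 / 2 + ε)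
  obtain ⟨f, hf, hlim⟩ : ∃ f : (ℕ → ℝ) × (ℕ → ℝ) → ℂ, StronglyMeasurable f ∧
      ∀ᵐ p ∂P.prod G, Filter.Tendsto (fun n => densSeq W (3 / 2 + ε) n p.1 p.2) Filter.atTop
        (nhds (f p)) := by
    refine exists_stronglyMeasurable_limit_of_tendsto_ae
      (fun n => (hmeas n).aestronglyMeasurable) ?_
    refine (Measure.ae_prod_iff_ae_ae (StronglyMeasurable.measurableSet_exists_tendsto hmeas)).2 ?_
    filter_upwards [hpos, hsum] with s hs hs'
    exact ae_exists_tendsto_densSeq hε hs hs' hW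
  have hlim' := Measure.ae_ae_of_ae_prod hlim
  have hfint : Integrable f (P.prod G) := by
    refine integrable_of_tendsto_of_lintegral_le hmeas hf hlim fun n => le_trans ?_ (hR n)
    rw [lintegral_prod _ (hmeas n).enorm.aemeasurable]
    refine lintegral_mono_ae ?_
    filter_upwards [hpos] with s hs using lintegral_norm_densSeq_le hW0 hs n
  set X : (ℕ → ℝ) × (ℕ → ℝ) → ℕ → ℝ := fun p => rescale (domVar W (3 / 2 + ε) p.1) p.2
  have hX : Measurable X :=
    measurable_rescale_uncurry.comp
      (((measurable_domVar W (3 / 2 + ε)).comp measurable_fst).prodMk measurable_snd)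
  refine ⟨((P.prod G).withDensityᵥ f).map X, fun n _ E hE => ?_, fun E hE hE' => ?_⟩
  · have hA : MeasurableSet (X ⁻¹' (firstCoords n ⁻¹' E)) := hX (measurable_firstCoords n hE)
    change ((P.prod G).withDensityᵥ f).map X (firstCoords n ⁻¹' E) = _
    rw [VectorMeasure.map_apply _ hX (measurable_firstCoords n hE), withDensityᵥ_apply hfint hA,
      setIntegral_prod_eq hfint hA, ← integral_setIntegral_gsn hβ0 (hR n) E]
    refine integral_congr_ae ?_
    filter_upwards [hpos, hsum, hlim'] with s hs hs' hs''
    exact setIntegral_lim_densSeq hε hs hs' hW hs'' n hE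
  · have hnull : P.prod G (X ⁻¹' E) = 0 := by
      rw [Measure.measure_prod_null (hX hE)]
      filter_upwards [hpos, hsγ] with s hs hs'
      refine measure_mono_null (fun z hz => hE' _ hz)
        (ae_summable_rescale hW0 hs (a := 3 / 2 + ε) (by linarith) hs')
    rw [VectorMeasure.map_apply _ hX hE, withDensityᵥ_apply hfint (hX hE),
      setIntegral_measure_zero _ hnull]
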